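/- arXiv:1402.4299 — 3 statements merged into one kernel-verified Lean document; each statement's English description precedes it below -/
import Mathlib

section
/- Let k be a field of characteristic 0, R = k[x₁, x₂, x₃, y₁, y₂, y₃, z], D the k-derivation of R with D(x_i) = 0, D(y_i) = x_i³ for i = 1,2,3, and D(z) = (x₁x₂x₃)², and A = ker D. Then the finite generation ideal of A equals the radical of the ideal of A generated by x₁, x₂, x₃: for a nonzero f ∈ A, the localization A_f is a finitely generated k-algebra if and only if some power of f lies in the ideal x₁A + x₂A + x₃A. -/
open MvPolynomial

/-- Roberts' derivation `D = x₁³ ∂/∂y₁ + x₂³ ∂/∂y₂ + x₃³ ∂/∂y₃ + (x₁x₂x₃)² ∂/∂z` on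
`k[x₁,x₂,x₃,y₁,y₂,y₃,z]`, with variables indexed `0,…,6` as `x₁,x₂,x₃,y₁,y₂,y₃,z`. -/
noncomputable def robertsD (k : Type*) [CommRing k] :
    Derivation k (MvPolynomial (Fin 7) k) (MvPolynomial (Fin 7) k) :=
  MvPolynomial.mkDerivation k
    ![0, 0, 0, X 0 ^ 3, X 1 ^ 3, X 2 ^ 3, (X 0 * X 1 * X 2) ^ 2]

/-- The ring of invariants `A = ker D` of Roberts' action, as a subalgebra of
`k[x₁,x₂,x₃,y₁,y₂,y₃,z]`. -/
noncomputable def robertsA (k : Type*) [CommRing k] :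
    Subalgebra k (MvPolynomial (Fin 7) k) where
  carrier := {f | robertsD k f = 0}
  mul_mem' := fun {a b} (ha : robertsD k a = 0) (hb : robertsD k b = 0) =>
    show robertsD k (a * b) = 0 by
      rw [Derivation.leibniz, ha, hb, smul_zero, smul_zero, add_zero]
  add_mem' := fun {a b} (ha : robertsD k a = 0) (hb : robertsD k b = 0) =>
    show robertsD k (a + b) = 0 by rw [map_add, ha, hb, add_zero]
  algebraMap_mem' := fun c => show robertsD k (algebraMap k _ c) = 0 from
    Derivation.map_algebraMap _ c

/-- The invariant `xᵢ` (for `i = 0, 1, 2`) as an element of the invariant ring. -/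
noncomputable def robertsXvar (k : Type*) [CommRing k] (i : Fin 3) : robertsA k :=
  ⟨X ⟨(i : ℕ), by omega⟩, show robertsD k _ = 0 by
    rw [robertsD, MvPolynomial.mkDerivation_X]
    fin_cases i <;> rfl⟩

namespace Roberts

/-- Polynomials in the seven variables. -/
abbrev Poly (k : Type*) [Field k] := MvPolynomial (Fin 7) k

/-- Exponent vectors in the seven variables. -/
abbrev Exponent := Fin 7 →₀ ℕ

variable {k : Type*} [Field k]

/-- The linear endomorphism sending each monomial to a multiple of a monomial. -/
noncomputable def monomialMap (t : Exponent → Exponent) (κ : Exponent → k) : Poly k →ₗ[k] Poly k :=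
  (basisMonomials (Fin 7) k).constr k fun s => monomial (t s) (κ s)

lemma monomialMap_monomial (t : Exponent → Exponent) (κ : Exponent → k) (s : Exponent) (a : k) :
    monomialMap t κ (monomial s a) = monomial (t s) (a * κ s) := by
  have h : monomial s a = a • basisMonomials (Fin 7) k s := by
    simp [coe_basisMonomials, smul_monomial]
  rw [h, map_smul, monomialMap, Module.Basis.constr_basis, smul_monomial, smul_eq_mul]

/-- The projection onto the span of the monomials of weight `c`. -/
noncomputable def proj (φ : Exponent → ℤ) (c : ℤ) : Poly k →ₗ[k] Poly k :=
  monomialMap id fun s => if φ s = c then 1 else 0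

lemma linearMap_ext {L L' : Poly k →ₗ[k] Poly k}
    (h : ∀ s a, L (monomial s a) = L' (monomial s a)) (p : Poly k) : L p = L' p := by
  induction p using MvPolynomial.induction_on' with
  | monomial s a => exact h s a
  | add p q hp hq => rw [map_add, map_add, hp, hq]

lemma proj_monomial (φ : Exponent → ℤ) (c : ℤ) (s : Exponent) (a : k) :
    proj φ c (monomial s a) = if φ s = c then monomial s a else 0 := by
  rw [proj, monomialMap_monomial]
  split_ifs <;> simp

lemma coeff_proj (φ : Exponent → ℤ) (c : ℤ) (s : Exponent) (p : Poly k) :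
    coeff s (proj φ c p) = if φ s = c then coeff s p else 0 := by
  induction p using MvPolynomial.induction_on' with
  | monomial t a =>
    rw [proj_monomial]
    by_cases hst : t = s
    · subst hst; split_ifs <;> simp
    · split_ifs <;> simp [coeff_monomial, hst]
  | add p q hp hq => rw [map_add, coeff_add, hp, hq, coeff_add]; split_ifs <;> simp

lemma proj_eq_self_iff {φ : Exponent → ℤ} {c : ℤ} {p : Poly k} :
    proj φ c p = p ↔ ∀ s, coeff s p ≠ 0 → φ s = c := by
  constructor
  · intro h s hs
    by_contra hc
    rw [← h, coeff_proj, if_neg hc] at hs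
    exact hs rfl
  · intro h
    ext s
    rw [coeff_proj]
    split_ifs with hc
    · rfl
    · exact (not_not.mp fun h0 => hc (h s h0)).symm

lemma proj_eq_zero_iff {φ : Exponent → ℤ} {c : ℤ} {p : Poly k} :
    proj φ c p = 0 ↔ ∀ s, coeff s p ≠ 0 → φ s ≠ c := by
  rw [MvPolynomial.ext_iff]
  refine forall_congr' fun s => ?_
  rw [coeff_proj, coeff_zero]
  split_ifs with h <;> simp [h]

lemma proj_proj (φ : Exponent → ℤ) (c : ℤ) (p : Poly k) :
    proj φ c (proj φ c p) = proj φ c p := by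
  rw [proj_eq_self_iff]
  intro s hs
  by_contra h
  rw [coeff_proj, if_neg h] at hs
  exact hs rfl

lemma proj_comm (φ ψ : Exponent → ℤ) (c d : ℤ) (p : Poly k) :
    proj φ c (proj ψ d p) = proj ψ d (proj φ c p) := by
  ext s
  simp only [coeff_proj]
  split_ifs <;> rfl

lemma sum_proj (φ : Exponent → ℤ) (p : Poly k) :
    ∑ c ∈ p.support.image φ, proj φ c p = p := by
  ext s
  rw [coeff_sum]
  simp only [coeff_proj]
  rw [Finset.sum_ite_eq]
  split_ifs with h
  · rfl
  · by_contra h0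
    exact h (Finset.mem_image_of_mem φ (mem_support_iff.mpr (Ne.symm h0)))

lemma mem_of_proj_mem {J : Submodule k (Poly k)} (φ : Exponent → ℤ) {p : Poly k}
    (h : ∀ c, proj φ c p ∈ J) : p ∈ J :=
  sum_proj φ p ▸ J.sum_mem fun c _ => h c

lemma eq_zero_of_proj_eq_zero (φ : Exponent → ℤ) {p : Poly k}
    (h : ∀ c, proj φ c p = 0) : p = 0 := by
  rw [← sum_proj φ p]
  exact Finset.sum_eq_zero fun c _ => h c

/-- `L` raises the weight `φ` by `d`. -/
def Shifts (φ : Exponent → ℤ) (d : ℤ) (L : Poly k →ₗ[k] Poly k) : Prop :=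
  ∀ c p, L (proj φ c p) = proj φ (c + d) (L p)

lemma Shifts.of_monomial {φ : Exponent → ℤ} {d : ℤ} {L : Poly k →ₗ[k] Poly k}
    (t : Exponent → Exponent) (κ : Exponent → k)
    (h : ∀ s a, L (monomial s a) = monomial (t s) (a * κ s))
    (ht : ∀ s, κ s ≠ 0 → φ (t s) = φ s + d) : Shifts φ d L := by
  intro c p
  refine linearMap_ext (L := L ∘ₗ proj φ c) (L' := proj φ (c + d) ∘ₗ L) (fun s a => ?_) p
  rw [LinearMap.comp_apply, LinearMap.comp_apply, h, proj_monomial, proj_monomial]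
  by_cases hκ : κ s = 0
  · split_ifs <;> simp [h, hκ]
  · rw [ht s hκ]
    by_cases hc : φ s = c
    · rw [if_pos hc, if_pos (by omega), h]
    · rw [if_neg hc, if_neg (by omega), map_zero]

lemma Shifts.comp {φ : Exponent → ℤ} {d d' e : ℤ} {L L' : Poly k →ₗ[k] Poly k}
    (h : Shifts φ d L) (h' : Shifts φ d' L') (he : d' + d = e) : Shifts φ e (L ∘ₗ L') := by
  intro c p
  rw [LinearMap.comp_apply, LinearMap.comp_apply, h', h, ← he, add_assoc]

lemma Shifts.add {φ : Exponent → ℤ} {d : ℤ} {L L' : Poly k →ₗ[k] Poly k}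
    (h : Shifts φ d L) (h' : Shifts φ d L') : Shifts φ d (L + L') := by
  intro c p
  rw [LinearMap.add_apply, LinearMap.add_apply, h, h', map_add]

lemma Shifts.sum {φ : Exponent → ℤ} {d : ℤ} {L : Fin 3 → Poly k →ₗ[k] Poly k}
    (h : ∀ i, Shifts φ d (L i)) : Shifts φ d (∑ i, L i) := by
  intro c p
  rw [LinearMap.sum_apply, LinearMap.sum_apply, map_sum]
  exact Finset.sum_congr rfl fun i _ => h i c p

lemma Shifts.pow {φ : Exponent → ℤ} {d : ℤ} {L : Poly k →ₗ[k] Poly k}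
    (h : Shifts φ d L) (n : ℕ) : Shifts φ (n * d) (L ^ n) := by
  induction n with
  | zero => intro c p; simp
  | succ n ih =>
    intro c p
    rw [pow_succ', Module.End.mul_apply, Module.End.mul_apply, ih, h]
    push_cast
    ring_nf

lemma Shifts.proj_eq {φ : Exponent → ℤ} {c d e : ℤ} {L : Poly k →ₗ[k] Poly k}
    (h : Shifts φ d L) {p : Poly k} (hp : proj φ c p = p) (he : c + d = e) :
    proj φ e (L p) = L p := by
  rw [← he, ← h, hp]

lemma Shifts.exists_pow_apply_eq_zero {φ : Exponent → ℤ} {L : Poly k →ₗ[k] Poly k}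
    (h : Shifts φ (-1) L) (hφ : ∀ s, 0 ≤ φ s) (p : Poly k) : ∃ n : ℕ, (L ^ n) p = 0 := by
  obtain ⟨n, hn⟩ : ∃ n : ℕ, ∀ s ∈ p.support, φ s < n := by
    refine ⟨(∑ s ∈ p.support, φ s).toNat + 1, fun s hs => ?_⟩
    have h1 : φ s ≤ ∑ t ∈ p.support, φ t := Finset.single_le_sum (fun t _ => hφ t) hs
    omega
  refine ⟨n, eq_zero_of_proj_eq_zero φ fun c => ?_⟩
  have hs := h.pow n (c + n) p
  rw [show c + n + n * (-1 : ℤ) = c by ring] at hs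
  rw [← hs]
  by_cases hc : 0 ≤ c
  · rw [proj_eq_zero_iff.mpr, map_zero]
    intro s hs
    have := hn s (mem_support_iff.mpr hs)
    omega
  · rw [hs, proj_eq_zero_iff]
    intro s _
    have := hφ s
    omega

/-- The index of `xᵢ`. -/
def xIdx (i : Fin 3) : Fin 7 := ⟨i, by omega⟩

/-- The index of `yᵢ`. -/
def yIdx (i : Fin 3) : Fin 7 := ⟨i + 3, by omega⟩

/-- The grading in which `xᵢ`, `yᵢ`, `z` have weights `1`, `-3`, `0`. -/
def eWeight (s : Exponent) : ℤ := (s 0 + s 1 + s 2 : ℕ) - 3 * (s 3 + s 4 + s 5 : ℕ)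

/-- The number of factors `xᵢ³`. -/
def cubeWeight (s : Exponent) : ℤ := (s 0 / 3 + s 1 / 3 + s 2 / 3 : ℕ)

/-- The degree in the `yᵢ`. -/
def yWeight (s : Exponent) : ℤ := (s 3 + s 4 + s 5 : ℕ)

/-- The `sl₂`-weight, in which `xᵢ³` has weight `1` and `yᵢ` has weight `-1`. -/
def hWeight (s : Exponent) : ℤ := cubeWeight s - yWeight s

/-- The exponent of `xᵢ` modulo `3`. -/
def residue (i : Fin 3) (s : Exponent) : ℤ := (s (xIdx i) % 3 : ℕ)

/-- The degree in `z`. -/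
def zWeight (s : Exponent) : ℤ := s 6

/-- Multiplication by a variable. -/
noncomputable def mulVar (j : Fin 7) : Poly k →ₗ[k] Poly k := LinearMap.mulLeft k (X j)

/-- Multiplication by `xᵢ³`. -/
noncomputable def mulCube (i : Fin 3) : Poly k →ₗ[k] Poly k :=
  LinearMap.mulLeft k (X (xIdx i) ^ 3)

/-- Partial derivative as a linear map. -/
noncomputable def del (j : Fin 7) : Poly k →ₗ[k] Poly k := (pderiv j).toLinearMap

/-- Differentiation with respect to `xᵢ³`, where `k[x]` is regarded as a free module over
`k[x₁³, x₂³, x₃³]`. -/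
noncomputable def delCube (i : Fin 3) : Poly k →ₗ[k] Poly k :=
  monomialMap (fun s => s - Finsupp.single (xIdx i) 3) fun s => ((s (xIdx i) / 3 : ℕ) : k)

/-- Antiderivative with respect to `z`. -/
noncomputable def integral : Poly k →ₗ[k] Poly k :=
  monomialMap (fun s => s + Finsupp.single 6 1) fun s => ((s 6 + 1 : ℕ) : k)⁻¹

/-- The derivation `∑ xᵢ³ ∂/∂yᵢ`. -/
noncomputable def raising : Poly k →ₗ[k] Poly k := ∑ i, mulCube i ∘ₗ del (yIdx i)

/-- The `sl₂`-lowering operator `∑ yᵢ ∂/∂(xᵢ³)`. -/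
noncomputable def lowering : Poly k →ₗ[k] Poly k := ∑ i, mulVar (yIdx i) ∘ₗ delCube i

lemma mulVar_apply (j : Fin 7) (p : Poly k) : mulVar j p = X j * p := rfl

lemma mulCube_apply (i : Fin 3) (p : Poly k) : mulCube i p = X (xIdx i) ^ 3 * p := rfl

lemma del_apply (j : Fin 7) (p : Poly k) : del j p = pderiv j p := rfl

lemma mulVar_monomial (j : Fin 7) (s : Exponent) (a : k) :
    mulVar j (monomial s a) = monomial (s + Finsupp.single j 1) (a * 1) := by
  rw [mulVar_apply, X, monomial_mul, add_comm, one_mul, mul_one]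

lemma mulCube_monomial (i : Fin 3) (s : Exponent) (a : k) :
    mulCube i (monomial s a) = monomial (s + Finsupp.single (xIdx i) 3) (a * 1) := by
  rw [mulCube_apply, X_pow_eq_monomial, monomial_mul, add_comm, one_mul, mul_one]

lemma del_monomial (j : Fin 7) (s : Exponent) (a : k) :
    del j (monomial s a) = monomial (s - Finsupp.single j 1) (a * (s j : k)) :=
  pderiv_monomial

lemma delCube_monomial (i : Fin 3) (s : Exponent) (a : k) :
    delCube i (monomial s a) =
      monomial (s - Finsupp.single (xIdx i) 3) (a * ((s (xIdx i) / 3 : ℕ) : k)) :=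
  monomialMap_monomial _ _ _ _

lemma integral_monomial (s : Exponent) (a : k) :
    integral (monomial s a) = monomial (s + Finsupp.single 6 1) (a * ((s 6 + 1 : ℕ) : k)⁻¹) :=
  monomialMap_monomial _ _ _ _

section Shifts

lemma shifts_mulVar_x_eWeight (i : Fin 3) : Shifts (k := k) eWeight 1 (mulVar (xIdx i)) :=
  .of_monomial _ _ (mulVar_monomial _) fun s _ => by
    fin_cases i <;> simp [eWeight, xIdx] <;> omega

lemma shifts_mulVar_y_eWeight (i : Fin 3) : Shifts (k := k) eWeight (-3) (mulVar (yIdx i)) :=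
  .of_monomial _ _ (mulVar_monomial _) fun s _ => by
    fin_cases i <;> simp [eWeight, yIdx] <;> omega

lemma shifts_mulVar_y_hWeight (i : Fin 3) : Shifts (k := k) hWeight (-1) (mulVar (yIdx i)) :=
  .of_monomial _ _ (mulVar_monomial _) fun s _ => by
    fin_cases i <;> simp [hWeight, cubeWeight, yWeight, yIdx] <;> omega

lemma shifts_mulVar_y_cubeWeight (i : Fin 3) :
    Shifts (k := k) cubeWeight 0 (mulVar (yIdx i)) :=
  .of_monomial _ _ (mulVar_monomial _) fun s _ => by
    fin_cases i <;> simp [cubeWeight, yIdx]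

lemma shifts_mulCube_eWeight (i : Fin 3) : Shifts (k := k) eWeight 3 (mulCube i) :=
  .of_monomial _ _ (mulCube_monomial _) fun s _ => by
    fin_cases i <;> simp [eWeight, xIdx] <;> omega

lemma shifts_mulCube_hWeight (i : Fin 3) : Shifts (k := k) hWeight 1 (mulCube i) :=
  .of_monomial _ _ (mulCube_monomial _) fun s _ => by
    fin_cases i <;> simp [hWeight, cubeWeight, yWeight, xIdx] <;> omega

lemma shifts_mulCube_yWeight (i : Fin 3) : Shifts (k := k) yWeight 0 (mulCube i) :=
  .of_monomial _ _ (mulCube_monomial _) fun s _ => by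
    fin_cases i <;> simp [yWeight, xIdx]

lemma shifts_mulCube_residue (i j : Fin 3) : Shifts (k := k) (residue j) 0 (mulCube i) :=
  .of_monomial _ _ (mulCube_monomial _) fun s _ => by
    fin_cases i <;> fin_cases j <;> simp [residue, xIdx]

lemma shifts_delCube_eWeight (i : Fin 3) : Shifts (k := k) eWeight (-3) (delCube i) :=
  .of_monomial _ _ (delCube_monomial _) fun s hs => by
    have : 3 ≤ s (xIdx i) := by
      by_contra h
      exact hs (by rw [Nat.div_eq_of_lt (by omega), Nat.cast_zero])
    fin_cases i <;> simp [eWeight, xIdx] at this ⊢ <;> omega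

lemma shifts_delCube_cubeWeight (i : Fin 3) : Shifts (k := k) cubeWeight (-1) (delCube i) :=
  .of_monomial _ _ (delCube_monomial _) fun s hs => by
    have : 3 ≤ s (xIdx i) := by
      by_contra h
      exact hs (by rw [Nat.div_eq_of_lt (by omega), Nat.cast_zero])
    fin_cases i <;> simp [cubeWeight, xIdx] at this ⊢ <;> omega

lemma shifts_delCube_hWeight (i : Fin 3) : Shifts (k := k) hWeight (-1) (delCube i) :=
  .of_monomial _ _ (delCube_monomial _) fun s hs => by
    have : 3 ≤ s (xIdx i) := by
      by_contra h
      exact hs (by rw [Nat.div_eq_of_lt (by omega), Nat.cast_zero])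
    fin_cases i <;>
      simp [hWeight, yWeight, cubeWeight, xIdx] at this ⊢ <;> omega

lemma shifts_del_y_eWeight (i : Fin 3) : Shifts (k := k) eWeight 3 (del (yIdx i)) :=
  .of_monomial _ _ (del_monomial _) fun s hs => by
    have : s (yIdx i) ≠ 0 := fun h => hs (by rw [h, Nat.cast_zero])
    fin_cases i <;> simp [eWeight, yIdx] at this ⊢ <;> omega

lemma shifts_del_y_yWeight (i : Fin 3) : Shifts (k := k) yWeight (-1) (del (yIdx i)) :=
  .of_monomial _ _ (del_monomial _) fun s hs => by
    have : s (yIdx i) ≠ 0 := fun h => hs (by rw [h, Nat.cast_zero])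
    fin_cases i <;> simp [yWeight, yIdx] at this ⊢ <;> omega

lemma shifts_del_y_hWeight (i : Fin 3) : Shifts (k := k) hWeight 1 (del (yIdx i)) :=
  .of_monomial _ _ (del_monomial _) fun s hs => by
    have : s (yIdx i) ≠ 0 := fun h => hs (by rw [h, Nat.cast_zero])
    fin_cases i <;>
      simp [hWeight, cubeWeight, yWeight, yIdx] at this ⊢ <;> omega

lemma shifts_del_y_residue (i j : Fin 3) : Shifts (k := k) (residue j) 0 (del (yIdx i)) :=
  .of_monomial _ _ (del_monomial _) fun s _ => by
    fin_cases i <;> fin_cases j <;> simp [residue, xIdx, yIdx]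

lemma shifts_del_z_of_weight {φ : Exponent → ℤ}
    (h : ∀ s : Exponent, φ (s - Finsupp.single 6 1) = φ s) : Shifts (k := k) φ 0 (del 6) :=
  .of_monomial _ _ (del_monomial _) fun s _ => by rw [h, add_zero]

lemma shifts_del_z_eWeight : Shifts (k := k) eWeight 0 (del 6) :=
  shifts_del_z_of_weight fun s => by simp [eWeight]

lemma shifts_del_z_hWeight : Shifts (k := k) hWeight 0 (del 6) :=
  shifts_del_z_of_weight fun s => by simp [hWeight, cubeWeight, yWeight]

lemma shifts_del_z_yWeight : Shifts (k := k) yWeight 0 (del 6) :=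
  shifts_del_z_of_weight fun s => by simp [yWeight]

lemma shifts_del_z_residue (i : Fin 3) : Shifts (k := k) (residue i) 0 (del 6) :=
  shifts_del_z_of_weight fun s => by
    fin_cases i <;> simp [residue, xIdx]

lemma shifts_del_z_zWeight : Shifts (k := k) zWeight (-1) (del 6) :=
  .of_monomial _ _ (del_monomial _) fun s hs => by
    have : s 6 ≠ 0 := fun h => hs (by rw [h, Nat.cast_zero])
    simp [zWeight]
    omega

lemma shifts_integral_eWeight : Shifts (k := k) eWeight 0 integral :=
  .of_monomial _ _ integral_monomial fun s _ => by
    simp [eWeight]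

lemma shifts_raising_eWeight : Shifts (k := k) eWeight 6 raising :=
  .sum fun i => (shifts_mulCube_eWeight i).comp (shifts_del_y_eWeight i) (by norm_num)

lemma shifts_raising_hWeight : Shifts (k := k) hWeight 2 raising :=
  .sum fun i => (shifts_mulCube_hWeight i).comp (shifts_del_y_hWeight i) (by norm_num)

lemma shifts_raising_yWeight : Shifts (k := k) yWeight (-1) raising :=
  .sum fun i => (shifts_mulCube_yWeight i).comp (shifts_del_y_yWeight i) (by norm_num)

lemma shifts_raising_residue (j : Fin 3) : Shifts (k := k) (residue j) 0 raising :=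
  .sum fun i => (shifts_mulCube_residue i j).comp (shifts_del_y_residue i j) (by norm_num)

lemma shifts_lowering_eWeight : Shifts (k := k) eWeight (-6) lowering :=
  .sum fun i => (shifts_mulVar_y_eWeight i).comp (shifts_delCube_eWeight i) (by norm_num)

lemma shifts_lowering_hWeight : Shifts (k := k) hWeight (-2) lowering :=
  .sum fun i => (shifts_mulVar_y_hWeight i).comp (shifts_delCube_hWeight i) (by norm_num)

lemma shifts_lowering_cubeWeight : Shifts (k := k) cubeWeight (-1) lowering :=
  .sum fun i => (shifts_mulVar_y_cubeWeight i).comp (shifts_delCube_cubeWeight i) (by norm_num)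

end Shifts

section Commutators

lemma add_single_tsub_single {i j : Fin 7} (h : i ≠ j) (s : Exponent) (m n : ℕ) :
    s + Finsupp.single j m - Finsupp.single i n = s - Finsupp.single i n + Finsupp.single j m := by
  ext l
  by_cases hl : l = i
  · subst hl
    simp [Finsupp.single_eq_of_ne h]
  · simp [Finsupp.single_eq_of_ne hl]

lemma delCube_mulCube (i j : Fin 3) (p : Poly k) :
    delCube i (mulCube j p) = mulCube j (delCube i p) + if i = j then p else 0 := by
  by_cases hij : i = j
  · subst hij
    rw [if_pos rfl]
    refine linearMap_ext (L := delCube i ∘ₗ mulCube i)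
      (L' := mulCube i ∘ₗ delCube i + LinearMap.id) (fun s a => ?_) p
    simp only [LinearMap.comp_apply, LinearMap.add_apply, LinearMap.id_apply, mulCube_monomial,
      delCube_monomial, add_tsub_cancel_right, Finsupp.add_apply, Finsupp.single_eq_same,
      Nat.add_div_right _ (show 0 < 3 by norm_num)]
    by_cases h : 3 ≤ s (xIdx i)
    · rw [tsub_add_cancel_of_le (Finsupp.single_le_iff.mpr h), ← map_add]
      push_cast
      ring_nf
    · rw [Nat.div_eq_of_lt (by omega)]
      simp
  · rw [if_neg hij, add_zero]
    have hx : xIdx i ≠ xIdx j := fun h => hij (by simpa [xIdx, Fin.ext_iff] using h)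
    refine linearMap_ext (L := delCube i ∘ₗ mulCube j) (L' := mulCube j ∘ₗ delCube i)
      (fun s a => ?_) p
    simp only [LinearMap.comp_apply, mulCube_monomial, delCube_monomial, Finsupp.add_apply,
      Finsupp.single_eq_of_ne hx, add_zero, mul_one]
    rw [add_single_tsub_single hx]

lemma delCube_del (i : Fin 3) (j : Fin 7) (h : xIdx i ≠ j) (p : Poly k) :
    delCube i (del j p) = del j (delCube i p) := by
  refine linearMap_ext (L := delCube i ∘ₗ del j) (L' := del j ∘ₗ delCube i) (fun s a => ?_) p
  simp only [LinearMap.comp_apply, del_monomial, delCube_monomial, Finsupp.tsub_apply,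
    Finsupp.single_eq_of_ne h, Finsupp.single_eq_of_ne h.symm, tsub_zero]
  rw [tsub_right_comm, mul_right_comm]

lemma xIdx_ne_yIdx (i j : Fin 3) : xIdx i ≠ yIdx j := by
  simp only [xIdx, yIdx, ne_eq, Fin.ext_iff]
  omega

lemma xIdx_ne_z (i : Fin 3) : xIdx i ≠ 6 := by
  simp only [xIdx, ne_eq, Fin.ext_iff]
  omega

lemma yIdx_ne_z (i : Fin 3) : yIdx i ≠ 6 := by
  simp only [yIdx, ne_eq, Fin.ext_iff]
  omega

lemma yIdx_injective : Function.Injective yIdx := fun i j h => by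
  simpa [yIdx, Fin.ext_iff] using h

lemma del_del (i j : Fin 7) (p : Poly k) : del i (del j p) = del j (del i p) := by
  refine linearMap_ext (L := del i ∘ₗ del j) (L' := del j ∘ₗ del i) (fun s a => ?_) p
  by_cases h : i = j
  · rw [h]
  · simp only [LinearMap.comp_apply, del_monomial, Finsupp.tsub_apply,
      Finsupp.single_eq_of_ne h, Finsupp.single_eq_of_ne (Ne.symm h), tsub_zero]
    rw [tsub_right_comm, mul_right_comm]

lemma del_mulCube (j : Fin 7) (i : Fin 3) (h : xIdx i ≠ j) (p : Poly k) :
    del j (mulCube i p) = mulCube i (del j p) := by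
  rw [mulCube_apply, mulCube_apply, del_apply, del_apply, Derivation.leibniz, pderiv_pow,
    pderiv_X_of_ne h]
  simp

lemma del_mulVar_of_ne (j l : Fin 7) (h : l ≠ j) (p : Poly k) :
    del j (mulVar l p) = mulVar l (del j p) := by
  rw [mulVar_apply, mulVar_apply, del_apply, del_apply, Derivation.leibniz, pderiv_X_of_ne h]
  simp

lemma del_mulVar_self (j : Fin 7) (p : Poly k) :
    del j (mulVar j p) = mulVar j (del j p) + p := by
  rw [mulVar_apply, mulVar_apply, del_apply, del_apply, Derivation.leibniz, pderiv_X_self]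
  simp

lemma mulCube_mulVar (i : Fin 3) (j : Fin 7) (p : Poly k) :
    mulCube i (mulVar j p) = mulVar j (mulCube i p) := by
  simp only [mulCube_apply, mulVar_apply]
  ring

lemma del_integral [CharZero k] (p : Poly k) : del 6 (integral p) = p := by
  refine linearMap_ext (L := del 6 ∘ₗ integral) (L' := LinearMap.id) (fun s a => ?_) p
  simp only [LinearMap.comp_apply, integral_monomial, del_monomial, add_tsub_cancel_right,
    Finsupp.add_apply, Finsupp.single_eq_same, LinearMap.id_apply]
  rw [inv_mul_cancel_right₀ (Nat.cast_ne_zero.mpr (by omega))]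

lemma raising_apply (p : Poly k) : raising p = ∑ i, mulCube i (del (yIdx i) p) := by
  simp [raising]

lemma lowering_apply (p : Poly k) : lowering p = ∑ i, mulVar (yIdx i) (delCube i p) := by
  simp [lowering]

lemma raising_delCube (i : Fin 3) (p : Poly k) :
    raising (delCube i p) = delCube i (raising p) - del (yIdx i) p := by
  simp only [raising_apply, map_sum, delCube_mulCube, Finset.sum_add_distrib, Finset.sum_ite_eq,
    Finset.mem_univ, if_true, add_sub_cancel_right]
  exact Finset.sum_congr rfl fun j _ => by rw [delCube_del _ _ (xIdx_ne_yIdx _ _)]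

lemma raising_del (j : Fin 7) (h : ∀ i, xIdx i ≠ j) (p : Poly k) :
    raising (del j p) = del j (raising p) := by
  simp only [raising_apply, map_sum]
  exact Finset.sum_congr rfl fun i _ => by rw [del_mulCube _ _ (h i), del_del]

lemma lowering_del_z (p : Poly k) : lowering (del 6 p) = del 6 (lowering p) := by
  simp only [lowering_apply, map_sum]
  exact Finset.sum_congr rfl fun i _ => by
    rw [del_mulVar_of_ne _ _ (yIdx_ne_z i), delCube_del _ _ (xIdx_ne_z i)]

lemma lowering_mulCube (i : Fin 3) (p : Poly k) :
    lowering (mulCube i p) = mulCube i (lowering p) + mulVar (yIdx i) p := by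
  simp only [lowering_apply, map_sum, delCube_mulCube, map_add, mulCube_mulVar,
    Finset.sum_add_distrib]
  congr 1
  rw [Finset.sum_eq_single i (fun j _ hj => by simp [hj]) (by simp)]
  simp

/-- `∑ xᵢ³ ∂/∂(xᵢ³)` multiplies monomials by their cube weight. -/
lemma sum_mulCube_delCube {c : ℤ} {p : Poly k} (hp : proj cubeWeight c p = p) :
    ∑ i, mulCube i (delCube i p) = (c : k) • p := by
  have h := linearMap_ext
    (L := (∑ i, mulCube i ∘ₗ delCube i) ∘ₗ proj cubeWeight c) (L' := (c : k) • proj cubeWeight c)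
    (fun s a => ?_) p
  · simpa [hp] using h
  · have hi (i : Fin 3) : mulCube i (delCube i (monomial s a)) =
        ((s (xIdx i) / 3 : ℕ) : k) • monomial s a := by
      rw [delCube_monomial, mulCube_monomial, smul_monomial, smul_eq_mul]
      by_cases h : 3 ≤ s (xIdx i)
      · rw [tsub_add_cancel_of_le (Finsupp.single_le_iff.mpr h), mul_one, mul_comm]
      · rw [Nat.div_eq_of_lt (by omega)]
        simp
    rw [LinearMap.comp_apply, LinearMap.smul_apply, proj_monomial]
    split_ifs with hc
    · simp only [LinearMap.sum_apply, LinearMap.comp_apply, hi, ← Finset.sum_smul]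
      rw [← hc, cubeWeight, Int.cast_natCast, Fin.sum_univ_three]
      push_cast
      rfl
    · simp

lemma sum_mulVar_del {c : ℤ} {p : Poly k} (hp : proj yWeight c p = p) :
    ∑ i, mulVar (yIdx i) (del (yIdx i) p) = (c : k) • p := by
  have h := linearMap_ext
    (L := (∑ i, mulVar (yIdx i) ∘ₗ del (yIdx i)) ∘ₗ proj yWeight c)
    (L' := (c : k) • proj yWeight c) (fun s a => ?_) p
  · simpa [hp] using h
  · rw [LinearMap.comp_apply, LinearMap.smul_apply, proj_monomial]
    split_ifs with hc
    · simp only [LinearMap.sum_apply, LinearMap.comp_apply, mulVar_apply, del_apply,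
        X_mul_pderiv_monomial, ← Finset.sum_smul]
      rw [← hc, yWeight, Int.cast_natCast, Fin.sum_univ_three, Nat.cast_smul_eq_nsmul]
      rfl
    · simp

end Commutators

section RepresentationTheory

lemma sum_mulCube_delCube_sub_sum_mulVar_del {c : ℤ} {p : Poly k} (hp : proj hWeight c p = p) :
    ∑ i, mulCube i (delCube i p) - ∑ i, mulVar (yIdx i) (del (yIdx i) p) = (c : k) • p := by
  have h := linearMap_ext
    (L := (∑ i, mulCube i ∘ₗ delCube i - ∑ i, mulVar (yIdx i) ∘ₗ del (yIdx i)) ∘ₗ proj hWeight c)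
    (L' := (c : k) • proj hWeight c) (fun s a => ?_) p
  · simpa [hp] using h
  · rw [LinearMap.comp_apply, LinearMap.smul_apply, proj_monomial]
    split_ifs with hc
    · have h1 := sum_mulCube_delCube (p := monomial s a) (c := cubeWeight s)
        (by rw [proj_monomial, if_pos rfl])
      have h2 := sum_mulVar_del (p := monomial s a) (c := yWeight s)
        (by rw [proj_monomial, if_pos rfl])
      simp only [LinearMap.sub_apply, LinearMap.sum_apply, LinearMap.comp_apply]
      rw [h1, h2, ← sub_smul, ← hc, hWeight, Int.cast_sub]
    · simp

lemma raising_mulVar_y (i : Fin 3) (p : Poly k) :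
    raising (mulVar (yIdx i) p) = mulVar (yIdx i) (raising p) + mulCube i p := by
  have h (j : Fin 3) : mulCube j (del (yIdx j) (mulVar (yIdx i) p)) =
      mulVar (yIdx i) (mulCube j (del (yIdx j) p)) + if j = i then mulCube j p else 0 := by
    by_cases hj : j = i
    · subst hj
      rw [del_mulVar_self, map_add, mulCube_mulVar, if_pos rfl]
    · rw [del_mulVar_of_ne _ _ fun h => hj (yIdx_injective h).symm, mulCube_mulVar, if_neg hj,
        add_zero]
  simp only [raising_apply, h, map_sum, Finset.sum_add_distrib, Finset.sum_ite_eq',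
    Finset.mem_univ, if_true]

lemma raising_lowering {c : ℤ} {p : Poly k} (hp : proj hWeight c p = p) :
    raising (lowering p) = lowering (raising p) + (c : k) • p := by
  rw [← sum_mulCube_delCube_sub_sum_mulVar_del hp]
  simp only [lowering_apply, map_sum, raising_mulVar_y, raising_delCube, map_sub]
  rw [Finset.sum_add_distrib, Finset.sum_sub_distrib]
  abel

lemma raising_lowering_pow {m : ℤ} {p : Poly k} (hp : proj hWeight m p = p)
    (h : lowering (raising p) = 0) (j : ℕ) :
    raising ((lowering ^ (j + 1)) p) = (((j + 1) * (m - j) : ℤ) : k) • (lowering ^ j) p := by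
  induction j with
  | zero => simp [raising_lowering hp, h]
  | succ j ih =>
    have hw : proj hWeight (m - 2 * (j + 1)) ((lowering ^ (j + 1)) p) = (lowering ^ (j + 1)) p :=
      (shifts_lowering_hWeight.pow (j + 1)).proj_eq hp (by push_cast; ring)
    rw [pow_succ' lowering (j + 1), Module.End.mul_apply, raising_lowering hw, ih, map_smul,
      ← Module.End.mul_apply, ← pow_succ', ← add_smul]
    congr 1
    push_cast
    ring

lemma eq_zero_of_lowering_raising_eq_zero [CharZero k] {m : ℤ} (hm : m < 0) {p : Poly k}
    (hp : proj hWeight m p = p) (h : lowering (raising p) = 0) : p = 0 := by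
  obtain ⟨n, hn⟩ := shifts_lowering_cubeWeight.exists_pow_apply_eq_zero
    (fun s => Int.natCast_nonneg _) p
  induction n with
  | zero => simpa using hn
  | succ j ih =>
    refine ih ?_
    have := raising_lowering_pow hp h j
    rw [hn, map_zero, eq_comm, smul_eq_zero] at this
    refine this.resolve_left fun h0 => ?_
    rw [Int.cast_eq_zero, mul_eq_zero] at h0
    omega

lemma raising_pow_lowering {m : ℤ} {p : Poly k} (hp : proj hWeight m p = p) (r : ℕ) :
    (raising ^ (r + 1)) (lowering p) =
      lowering ((raising ^ (r + 1)) p) + (((r + 1) * (m + r) : ℤ) : k) • (raising ^ r) p := by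
  induction r with
  | zero => simp [raising_lowering hp]
  | succ r ih =>
    have hw : proj hWeight (m + 2 * (r + 1)) ((raising ^ (r + 1)) p) = (raising ^ (r + 1)) p :=
      (shifts_raising_hWeight.pow (r + 1)).proj_eq hp (by push_cast; ring)
    rw [pow_succ' raising (r + 1), Module.End.mul_apply, ih, map_add, map_smul,
      raising_lowering hw, ← Module.End.mul_apply raising (raising ^ r), ← pow_succ',
      Module.End.mul_apply, add_assoc, ← add_smul]
    congr 2
    push_cast
    ring

lemma exists_raising_lowering_eq_of_pow [CharZero k] {m : ℤ} (hm : 0 < m)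
    {W : Submodule k (Poly k)} (hW : ∀ p ∈ W, raising (lowering p) ∈ W) (r : ℕ) :
    ∀ p ∈ W, proj hWeight m p = p → (raising ^ r) p = 0 → ∃ t ∈ W, raising (lowering t) = p := by
  induction r with
  | zero =>
    intro p _ _ hr
    exact ⟨0, W.zero_mem, by simpa using hr.symm⟩
  | succ r ih =>
    intro p hpW hp hr
    have hc : (((r + 1) * (m + r) : ℤ) : k) ≠ 0 := by
      rw [Int.cast_ne_zero]
      positivity
    obtain ⟨t, htW, ht⟩ := ih (p - (((r + 1) * (m + r) : ℤ) : k)⁻¹ • raising (lowering p))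
      (W.sub_mem hpW (W.smul_mem _ (hW p hpW)))
      (by
        rw [map_sub, map_smul, hp, shifts_raising_hWeight.proj_eq
          (shifts_lowering_hWeight.proj_eq hp rfl) (by ring)])
      (by
        rw [map_sub, map_smul, ← Module.End.mul_apply, ← pow_succ, raising_pow_lowering hp, hr,
          map_zero, zero_add, smul_smul, inv_mul_cancel₀ hc, one_smul, sub_self])
    refine ⟨t + (((r + 1) * (m + r) : ℤ) : k)⁻¹ • p, W.add_mem htW (W.smul_mem _ hpW), ?_⟩
    rw [map_add, map_add, map_smul, map_smul, ht, sub_add_cancel]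

lemma exists_raising_lowering_eq [CharZero k] {W : Submodule k (Poly k)}
    (hW : ∀ p ∈ W, raising (lowering p) ∈ W) (hproj : ∀ p ∈ W, ∀ c, proj hWeight c p ∈ W)
    (hpos : ∀ p ∈ W, ∀ s, coeff s p ≠ 0 → 0 < hWeight s) {p : Poly k} (hp : p ∈ W) :
    ∃ t ∈ W, raising (lowering t) = p := by
  refine mem_of_proj_mem (J := W.map (raising ∘ₗ lowering)) hWeight fun c => ?_
  by_cases hc : 0 < c
  · obtain ⟨r, hr⟩ := shifts_raising_yWeight.exists_pow_apply_eq_zero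
      (fun s => Int.natCast_nonneg _) (proj hWeight c p)
    exact exists_raising_lowering_eq_of_pow hc hW r _ (hproj p hp c) (proj_proj _ _ _) hr
  · rw [proj_eq_zero_iff.mpr fun s hs => by have := hpos p hp s hs; omega]
    exact Submodule.zero_mem _

lemma three_mul_hWeight_le (s : Exponent) : 3 * hWeight s ≤ eWeight s := by
  simp only [hWeight, eWeight, cubeWeight, yWeight]
  omega

lemma eWeight_le (s : Exponent) : eWeight s ≤ 3 * hWeight s + 6 := by
  simp only [hWeight, eWeight, cubeWeight, yWeight]
  omega

lemma hWeight_nonneg_of_raising_eq_zero [CharZero k] {p : Poly k} (hp : raising p = 0)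
    {s : Exponent} (hs : coeff s p ≠ 0) : 0 ≤ hWeight s := by
  by_contra! h
  have h0 : proj hWeight (hWeight s) p = 0 := by
    refine eq_zero_of_lowering_raising_eq_zero h (proj_proj _ _ _) ?_
    rw [shifts_raising_hWeight, hp, map_zero, map_zero]
  exact proj_eq_zero_iff.mp h0 s hs rfl

/-- The monomial `(x₁x₂x₃)²`. -/
noncomputable def cocycle (k : Type*) [Field k] : Poly k := (X 0 * X 1 * X 2) ^ 2

lemma cocycle_eq_monomial : cocycle k = monomial
    (Finsupp.single 0 2 + Finsupp.single 1 2 + Finsupp.single 2 2) 1 := by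
  simp only [cocycle, mul_pow, X_pow_eq_monomial, monomial_mul, one_mul]

lemma cocycle_ne_zero : cocycle k ≠ 0 := by
  simp [cocycle, X_ne_zero]

lemma raising_mul_of_raising_eq_zero (a : Poly k) (ha : ∀ i, pderiv (yIdx i) a = 0) (p : Poly k) :
    raising (a * p) = a * raising p := by
  simp only [raising_apply, mulCube_apply, del_apply, Derivation.leibniz, ha, smul_eq_mul,
    mul_zero, add_zero, Finset.mul_sum]
  exact Finset.sum_congr rfl fun i _ => by ring

lemma pderiv_y_cocycle (i : Fin 3) : pderiv (yIdx i) (cocycle k) = 0 := by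
  fin_cases i <;> simp [cocycle, yIdx, Derivation.leibniz_pow]

lemma eq_zero_of_raising_eq_cocycle_mul [CharZero k] {g u : Poly k} (hg : raising g = 0)
    (hw : proj eWeight 0 g = g) (hu : raising u = cocycle k * g) : g = 0 := by
  have hv : proj hWeight 0 (cocycle k * g) = cocycle k * g := by
    rw [proj_eq_self_iff]
    intro s hs
    rw [cocycle_eq_monomial, coeff_monomial_mul'] at hs
    split_ifs at hs with hle
    · have h1 := hWeight_nonneg_of_raising_eq_zero hg (right_ne_zero_of_mul hs)
      have h2 := proj_eq_self_iff.mp hw _ (right_ne_zero_of_mul hs)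
      have hle0 := hle 0
      have hle1 := hle 1
      have hle2 := hle 2
      simp [hWeight, eWeight, cubeWeight, yWeight] at *
      omega
    · exact absurd rfl hs
  have hEv : raising (cocycle k * g) = 0 := by
    rw [raising_mul_of_raising_eq_zero _ pderiv_y_cocycle, hg, mul_zero]
  have hFv : lowering (cocycle k * g) = 0 := by
    refine eq_zero_of_lowering_raising_eq_zero (m := -2) (by norm_num)
      (shifts_lowering_hWeight.proj_eq hv (by norm_num)) ?_
    rw [raising_lowering hv, hEv]
    simp
  have hproj : raising (proj hWeight (-2) u) = cocycle k * g := by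
    rw [shifts_raising_hWeight, hu, show (-2 + 2 : ℤ) = 0 by norm_num, hv]
  have hu0 : proj hWeight (-2) u = 0 := by
    refine eq_zero_of_lowering_raising_eq_zero (m := -2) (by norm_num) (proj_proj _ _ _) ?_
    rw [hproj, hFv]
  rw [hu0, map_zero] at hproj
  exact (mul_eq_zero.mp hproj.symm).resolve_left cocycle_ne_zero

end RepresentationTheory

section Invariants

lemma robertsD_apply (p : Poly k) : robertsD k p = raising p + cocycle k * del 6 p := by
  have h : robertsD k = ∑ i, (X (xIdx i) ^ 3 : Poly k) • pderiv (yIdx i) +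
      cocycle k • pderiv 6 := by
    refine derivation_ext fun j => ?_
    rw [robertsD, mkDerivation_X]
    fin_cases j <;>
      simp [Fin.sum_univ_three, xIdx, yIdx, cocycle]
  rw [h]
  simp [raising_apply, mulCube_apply, del_apply, Fin.sum_univ_three]

lemma robertsD_of_del_eq_zero {p : Poly k} (hp : del 6 p = 0) : robertsD k p = raising p := by
  rw [robertsD_apply, hp, mul_zero, add_zero]

lemma del_cocycle_mul (p : Poly k) : del 6 (cocycle k * p) = cocycle k * del 6 p := by
  rw [del_apply, Derivation.leibniz]
  simp [cocycle, del_apply, Derivation.leibniz_pow]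

lemma robertsD_del (p : Poly k) : robertsD k (del 6 p) = del 6 (robertsD k p) := by
  rw [robertsD_apply, robertsD_apply, map_add, del_cocycle_mul, raising_del 6 xIdx_ne_z]

lemma robertsD_del_pow (n : ℕ) {p : Poly k} (hp : robertsD k p = 0) :
    robertsD k ((del 6 ^ n) p) = 0 := by
  induction n with
  | zero => simpa using hp
  | succ n ih => rw [pow_succ', Module.End.mul_apply, robertsD_del, ih, map_zero]

lemma shifts_robertsD : Shifts (k := k) eWeight 6 (robertsD k).toLinearMap := by
  have h : Shifts (k := k) eWeight 6 (LinearMap.mulLeft k (cocycle k) ∘ₗ del 6) := by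
    refine Shifts.comp (d := 6) (.of_monomial
      (fun s => Finsupp.single 0 2 + Finsupp.single 1 2 + Finsupp.single 2 2 + s) (fun _ => 1)
      (fun s a => ?_) fun s _ => ?_) shifts_del_z_eWeight (by norm_num)
    · rw [LinearMap.mulLeft_apply, cocycle_eq_monomial, monomial_mul, one_mul, mul_one]
    · simp [eWeight]
      ring
  intro c p
  have := (shifts_raising_eWeight (k := k)).add h c p
  simpa [robertsD_apply] using this

lemma robertsD_proj {p : Poly k} (hp : robertsD k p = 0) (c : ℤ) :
    robertsD k (proj eWeight c p) = 0 := by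
  have := shifts_robertsD c p
  simpa [hp] using this

lemma del_pow_proj_eq {c : ℤ} {p : Poly k} (hp : proj eWeight c p = p) (n : ℕ) :
    proj eWeight c ((del 6 ^ n) p) = (del 6 ^ n) p :=
  (shifts_del_z_eWeight.pow n).proj_eq hp (by ring)

lemma exists_del_pow_eq_zero (p : Poly k) : ∃ n : ℕ, (del 6 ^ n) p = 0 :=
  shifts_del_z_zWeight.exists_pow_apply_eq_zero (fun _ => Int.natCast_nonneg _) p

lemma mulVar_proj_eq {c d : ℤ} {p : Poly k} (i : Fin 3) (hp : proj eWeight c p = p)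
    (h : c + 1 = d) : proj eWeight d (mulVar (xIdx i) p) = mulVar (xIdx i) p :=
  (shifts_mulVar_x_eWeight i).proj_eq hp h

lemma exists_of_coeff_mul_ne_zero {p q : Poly k} {u : Exponent} (h : coeff u (p * q) ≠ 0) :
    ∃ s t, s + t = u ∧ coeff s p ≠ 0 ∧ coeff t q ≠ 0 := by
  rw [coeff_mul] at h
  obtain ⟨⟨s, t⟩, hst, hne⟩ := Finset.exists_ne_zero_of_sum_ne_zero h
  exact ⟨s, t, Finset.HasAntidiagonal.mem_antidiagonal.mp hst, left_ne_zero_of_mul hne,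
    right_ne_zero_of_mul hne⟩

lemma eWeight_add (s t : Exponent) : eWeight (s + t) = eWeight s + eWeight t := by
  simp only [eWeight, Finsupp.add_apply]
  push_cast
  ring

lemma mul_proj_eq {c d : ℤ} {p q : Poly k} (hp : proj eWeight c p = p)
    (hq : proj eWeight d q = q) : proj eWeight (c + d) (p * q) = p * q := by
  rw [proj_eq_self_iff] at *
  intro u hu
  obtain ⟨s, t, rfl, hs, ht⟩ := exists_of_coeff_mul_ne_zero hu
  rw [eWeight_add, hp s hs, hq t ht]

lemma eq_zero_of_robertsD_eq_zero_of_neg [CharZero k] {c : ℤ} (hc : c < 0) {p : Poly k}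
    (hp : robertsD k p = 0) (hw : proj eWeight c p = p) : p = 0 := by
  obtain ⟨n, hn⟩ := exists_del_pow_eq_zero p
  induction n with
  | zero => simpa using hn
  | succ n ih =>
    refine ih ?_
    have hz : del 6 ((del 6 ^ n) p) = 0 := by rw [← Module.End.mul_apply, ← pow_succ', hn]
    have hE : raising ((del 6 ^ n) p) = 0 := by
      rw [← robertsD_of_del_eq_zero hz, robertsD_del_pow n hp]
    ext s
    rw [coeff_zero]
    by_contra hs
    have h1 := hWeight_nonneg_of_raising_eq_zero hE hs
    have h2 := proj_eq_self_iff.mp (del_pow_proj_eq hw n) s hs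
    have h3 := three_mul_hWeight_le s
    omega

lemma del_eq_zero_of_robertsD_eq_zero [CharZero k] {p : Poly k}
    (hp : robertsD k p = 0) (hw : proj eWeight 0 p = p) : del 6 p = 0 := by
  obtain ⟨n, hn⟩ := exists_del_pow_eq_zero p
  induction n with
  | zero => rw [show p = 0 by simpa using hn, map_zero]
  | succ n ih =>
    rcases n with _ | n
    · simpa using hn
    refine ih ?_
    have hg : del 6 ((del 6 ^ n) p) = (del 6 ^ (n + 1)) p := by
      rw [← Module.End.mul_apply, ← pow_succ']
    have hz : del 6 ((del 6 ^ (n + 1)) p) = 0 := by rw [← Module.End.mul_apply, ← pow_succ', hn]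
    have hE : raising ((del 6 ^ (n + 1)) p) = 0 := by
      rw [← robertsD_of_del_eq_zero hz, robertsD_del_pow _ hp]
    refine eq_zero_of_raising_eq_cocycle_mul (u := X 6 * (del 6 ^ (n + 1)) p - (del 6 ^ n) p) hE
      (del_pow_proj_eq hw _) ?_
    have hu : del 6 (X 6 * (del 6 ^ (n + 1)) p - (del 6 ^ n) p) = 0 := by
      rw [map_sub, ← mulVar_apply, del_mulVar_self, hz, hg, map_zero, zero_add, sub_self]
    rw [← robertsD_of_del_eq_zero hu, map_sub, robertsD_del_pow n hp, Derivation.leibniz,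
      robertsD_del_pow (n + 1) hp, smul_zero, zero_add, sub_zero, robertsD, mkDerivation_X,
      smul_eq_mul, mul_comm]
    rfl

/-- The invariants of weight `c` not involving `z`. -/
noncomputable def zFree (k : Type*) [Field k] (c : ℤ) : Submodule k (Poly k) :=
  LinearMap.ker raising ⊓ LinearMap.ker (del 6) ⊓ LinearMap.eqLocus (proj eWeight c) LinearMap.id

/-- The invariants of weight `c`. -/
noncomputable def invariants (k : Type*) [Field k] (c : ℤ) : Submodule k (Poly k) :=
  LinearMap.ker (robertsD k).toLinearMap ⊓ LinearMap.eqLocus (proj eWeight c) LinearMap.id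

/-- The sum of the images of `S` under multiplication by the `xᵢ`. -/
noncomputable def sumMulVar (S : Submodule k (Poly k)) : Submodule k (Poly k) :=
  ⨆ i, S.map (mulVar (xIdx i))

lemma mem_zFree {c : ℤ} {p : Poly k} :
    p ∈ zFree k c ↔ raising p = 0 ∧ del 6 p = 0 ∧ proj eWeight c p = p := by
  simp [zFree, and_assoc]

lemma mem_invariants {c : ℤ} {p : Poly k} :
    p ∈ invariants k c ↔ robertsD k p = 0 ∧ proj eWeight c p = p := by
  simp [invariants]

lemma mulVar_mem_sumMulVar {S : Submodule k (Poly k)} {p : Poly k} (i : Fin 3) (hp : p ∈ S) :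
    mulVar (xIdx i) p ∈ sumMulVar S :=
  Submodule.mem_iSup_of_mem i (Submodule.mem_map_of_mem hp)

lemma sumMulVar_le {S T : Submodule k (Poly k)}
    (h : ∀ i, ∀ p ∈ S, mulVar (xIdx i) p ∈ T) : sumMulVar S ≤ T :=
  iSup_le fun i => Submodule.map_le_iff_le_comap.mpr fun p hp => h i p hp

lemma proj_mem_zFree {φ : Exponent → ℤ} {c d : ℤ} {p : Poly k} (hp : p ∈ zFree k c)
    (hE : Shifts (k := k) φ d raising) (hz : Shifts (k := k) φ 0 (del 6)) (b : ℤ) :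
    proj φ b p ∈ zFree k c := by
  rw [mem_zFree] at *
  exact ⟨by rw [hE, hp.1, map_zero], by rw [hz, hp.2.1, map_zero], by rw [proj_comm, hp.2.2]⟩

lemma raising_mulVar_x (i : Fin 3) (p : Poly k) :
    raising (mulVar (xIdx i) p) = mulVar (xIdx i) (raising p) :=
  raising_mul_of_raising_eq_zero _ (fun j => pderiv_X_of_ne (xIdx_ne_yIdx i j)) p

lemma mem_sumMulVar_of_forall_ne_zero {c : ℤ} {p : Poly k} (hp : p ∈ zFree k c) (i : Fin 3)
    (h : ∀ s, coeff s p ≠ 0 → s (xIdx i) ≠ 0) : p ∈ sumMulVar (zFree k (c - 1)) := by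
  have hdvd : X (xIdx i) ∣ p := by
    rw [X_dvd_iff_modMonomial_eq_zero]
    ext s
    rw [coeff_zero]
    by_cases hs : Finsupp.single (xIdx i) 1 ≤ s
    · exact coeff_modMonomial_of_le _ hs
    · rw [coeff_modMonomial_of_not_le _ hs]
      by_contra h0
      exact hs (Finsupp.single_le_iff.mpr (Nat.one_le_iff_ne_zero.mpr (h s h0)))
  obtain ⟨q, rfl⟩ := hdvd
  refine mulVar_mem_sumMulVar i ?_
  have hx : (X (xIdx i) : Poly k) ≠ 0 := X_ne_zero _
  rw [mem_zFree] at *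
  rw [← mulVar_apply, raising_mulVar_x, del_mulVar_of_ne _ _ (xIdx_ne_z i)] at hp
  refine ⟨(mul_eq_zero.mp hp.1).resolve_left hx, (mul_eq_zero.mp hp.2.1).resolve_left hx,
    mul_left_cancel₀ hx ?_⟩
  have := shifts_mulVar_x_eWeight i (c - 1) q
  rwa [sub_add_cancel, hp.2.2] at this

lemma del_delCube_z (i : Fin 3) (p : Poly k) : del 6 (delCube i p) = delCube i (del 6 p) :=
  (delCube_del _ _ (xIdx_ne_z i) p).symm

lemma mem_sumMulVar_of_residue_eq_zero [CharZero k] {c y : ℤ} (hc : 0 < c) {p : Poly k}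
    (hp : p ∈ zFree k c) (hr : ∀ i s, coeff s p ≠ 0 → residue i s = 0)
    (hy : proj yWeight y p = p) : p ∈ sumMulVar (zFree k (c - 1)) := by
  by_cases hp0 : p = 0
  · rw [hp0]
    exact Submodule.zero_mem _
  obtain ⟨t, ht⟩ := ne_zero_iff.mp hp0
  obtain ⟨hE, hz, hw⟩ := mem_zFree.mp hp
  rw [proj_eq_self_iff] at hy
  have hw' := proj_eq_self_iff.mp hw
  have h3 (s : Exponent) (hs : coeff s p ≠ 0) : 3 * hWeight s = c ∧ yWeight s = y := by
    have h0 := hr 0 s hs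
    have h1 := hr 1 s hs
    have h2 := hr 2 s hs
    refine ⟨?_, hy s hs⟩
    rw [← hw' s hs]
    simp [residue, xIdx, hWeight, eWeight, cubeWeight, yWeight] at *
    omega
  obtain ⟨m, rfl⟩ : ∃ m, c = 3 * m := ⟨_, (h3 t ht).1.symm⟩
  have hy0 : 0 ≤ y := (h3 t ht).2 ▸ Int.natCast_nonneg _
  have hh : proj hWeight m p = p := proj_eq_self_iff.mpr fun s hs => by
    have := (h3 s hs).1
    omega
  have hX : proj cubeWeight (m + y) p = p := proj_eq_self_iff.mpr fun s hs => by
    have := h3 s hs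
    rw [hWeight] at this
    omega
  let u (i : Fin 3) : Poly k :=
    ((m + 1 : ℤ) : k) • delCube i p + lowering (del (yIdx i) p)
  have hu (i : Fin 3) : mulCube i (u i) ∈ sumMulVar (zFree k (3 * m - 1)) := by
    have : mulCube i (u i) = mulVar (xIdx i) (mulVar (xIdx i) (mulVar (xIdx i) (u i))) := by
      simp only [mulCube_apply, mulVar_apply]
      ring
    rw [this]
    refine mulVar_mem_sumMulVar i (mem_zFree.mpr ⟨?_, ?_, ?_⟩)
    · rw [raising_mulVar_x, raising_mulVar_x, map_add, map_smul, raising_delCube, hE,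
        raising_lowering (shifts_del_y_hWeight i |>.proj_eq hh rfl),
        raising_del _ (fun j => xIdx_ne_yIdx j i), hE]
      simp
    · rw [del_mulVar_of_ne _ _ (xIdx_ne_z i), del_mulVar_of_ne _ _ (xIdx_ne_z i), map_add,
        map_smul, del_delCube_z, hz, ← lowering_del_z, del_del, hz]
      simp
    · refine mulVar_proj_eq i (mulVar_proj_eq i (c := 3 * m - 3) ?_ rfl) (by ring)
      rw [map_add, map_smul, (shifts_delCube_eWeight i).proj_eq hw (by ring),
        shifts_lowering_eWeight.proj_eq ((shifts_del_y_eWeight i).proj_eq hw rfl) (by ring)]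
  have hsum : ∑ i, mulCube i (u i) = ((m * (m + y + 1) : ℤ) : k) • p := by
    have h1 : ∑ i, mulCube i (lowering (del (yIdx i) p)) = -((y : k) • p) := by
      rw [← sum_mulVar_del (proj_eq_self_iff.mpr hy), eq_neg_iff_add_eq_zero,
        ← Finset.sum_add_distrib, ← map_zero lowering, ← hE, raising_apply, map_sum]
      exact Finset.sum_congr rfl fun i _ => (lowering_mulCube i _).symm
    simp only [u, map_add, map_smul, Finset.sum_add_distrib]
    rw [← Finset.smul_sum, sum_mulCube_delCube hX, h1, smul_smul, ← sub_eq_add_neg, ← sub_smul]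
    congr 1
    push_cast
    ring
  have hne : ((m * (m + y + 1) : ℤ) : k) ≠ 0 := by
    rw [Int.cast_ne_zero]
    have : 0 < m := by omega
    positivity
  rw [← inv_smul_smul₀ hne p, ← hsum]
  exact Submodule.smul_mem _ _ (Submodule.sum_mem _ fun i _ => hu i)

lemma zFree_le_sumMulVar [CharZero k] {c : ℤ} (hc : 0 < c) :
    zFree k c ≤ sumMulVar (zFree k (c - 1)) := by
  have hres (i : Fin 3) {p : Poly k} (hp : p ∈ zFree k c)
      (h : proj (residue i) 0 p ∈ sumMulVar (zFree k (c - 1))) :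
      p ∈ sumMulVar (zFree k (c - 1)) := by
    refine mem_of_proj_mem (residue i) fun b => ?_
    by_cases hb : b = 0
    · rwa [hb]
    · refine mem_sumMulVar_of_forall_ne_zero
        (proj_mem_zFree hp (shifts_raising_residue i) (shifts_del_z_residue i) b) i
        fun s hs h0 => hb ?_
      rw [← proj_eq_self_iff.mp (proj_proj _ _ _) s hs, residue, h0]
      rfl
  have hz {p : Poly k} (i : Fin 3) (hp : p ∈ zFree k c) : proj (residue i) 0 p ∈ zFree k c :=
    proj_mem_zFree hp (shifts_raising_residue i) (shifts_del_z_residue i) 0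
  intro p hp
  refine hres 0 hp (hres 1 (hz 0 hp) (hres 2 (hz 1 (hz 0 hp)) ?_))
  refine mem_of_proj_mem yWeight fun y => mem_sumMulVar_of_residue_eq_zero hc
    (proj_mem_zFree (hz 2 (hz 1 (hz 0 hp))) shifts_raising_yWeight shifts_del_z_yWeight y) ?_
    (proj_proj _ _ _)
  intro i s hs
  simp only [coeff_proj] at hs
  fin_cases i <;> by_contra h <;> simp_all

lemma exists_del_pow_eq_X [CharZero k] (i : Fin 3) (n : ℕ) :
    ∃ β ∈ invariants k 1, (del 6 ^ n) β = X (xIdx i) := by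
  induction n with
  | zero =>
    refine ⟨X (xIdx i), mem_invariants.mpr ⟨?_, ?_⟩, rfl⟩
    · fin_cases i <;> simp [robertsD, xIdx]
    · rw [proj_eq_self_iff]
      intro s hs
      rw [coeff_X] at hs
      split_ifs at hs with h
      · subst h
        fin_cases i <;> simp [eWeight, xIdx]
      · exact absurd rfl hs
  | succ n ih =>
    obtain ⟨β, hβ, hn⟩ := ih
    obtain ⟨hD, hw⟩ := mem_invariants.mp hβ
    let W : Submodule k (Poly k) :=
      LinearMap.ker (del 6) ⊓ LinearMap.eqLocus (proj eWeight 7) LinearMap.id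
    have hmem {p : Poly k} : p ∈ W ↔ del 6 p = 0 ∧ proj eWeight 7 p = p := by simp [W]
    have hβw := shifts_integral_eWeight.proj_eq hw (add_zero 1)
    obtain ⟨t, htW, ht⟩ := exists_raising_lowering_eq (W := W) (p := robertsD k (integral β))
      (fun p hp => by
        rw [hmem] at hp ⊢
        refine ⟨?_, shifts_raising_eWeight.proj_eq (shifts_lowering_eWeight.proj_eq hp.2 rfl)
          (by norm_num)⟩
        rw [← raising_del _ xIdx_ne_z, ← lowering_del_z, hp.1, map_zero, map_zero])
      (fun p hp c => by
        rw [hmem] at hp ⊢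
        exact ⟨by rw [shifts_del_z_hWeight, hp.1, map_zero], by rw [proj_comm, hp.2]⟩)
      (fun p hp s hs => by
        have h1 := proj_eq_self_iff.mp (hmem.mp hp).2 s hs
        have h2 := eWeight_le s
        omega)
      (hmem.mpr ⟨by rw [← robertsD_del, del_integral, hD],
        shifts_robertsD.proj_eq hβw (by norm_num)⟩)
    obtain ⟨htz, htw⟩ := hmem.mp htW
    have hz : del 6 (lowering t) = 0 := by rw [← lowering_del_z, htz, map_zero]
    refine ⟨integral β - lowering t, mem_invariants.mpr ⟨?_, ?_⟩, ?_⟩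
    · rw [map_sub, robertsD_of_del_eq_zero hz, ht, sub_self]
    · rw [map_sub, hβw, shifts_lowering_eWeight.proj_eq htw (by norm_num)]
    · rw [pow_succ, Module.End.mul_apply, map_sub, del_integral, hz, sub_zero, hn]

lemma del_pow_mul_of_del_eq_zero {u : Poly k} (hu : del 6 u = 0) (p : Poly k) (n : ℕ) :
    (del 6 ^ n) (u * p) = u * (del 6 ^ n) p := by
  induction n with
  | zero => rfl
  | succ n ih =>
    rw [del_apply] at hu
    rw [pow_succ', Module.End.mul_apply, ih, Module.End.mul_apply, del_apply, del_apply,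
      Derivation.leibniz, hu, smul_zero, add_zero, smul_eq_mul]

lemma zFree_le_map_del_pow [CharZero k] {c : ℤ} (hc : 0 < c) (n : ℕ) :
    zFree k c ≤ (invariants k c).map (del 6 ^ n) := by
  refine (zFree_le_sumMulVar hc).trans (sumMulVar_le fun i u hu => ?_)
  obtain ⟨hE, hz, hw⟩ := mem_zFree.mp hu
  obtain ⟨β, hβ, hn⟩ := exists_del_pow_eq_X (k := k) i n
  obtain ⟨hD, hβw⟩ := mem_invariants.mp hβ
  refine ⟨u * β, mem_invariants.mpr ⟨?_, ?_⟩, ?_⟩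
  · rw [Derivation.leibniz, hD, robertsD_of_del_eq_zero hz, hE, smul_zero, smul_zero, add_zero]
  · simpa using mul_proj_eq hw hβw
  · rw [del_pow_mul_of_del_eq_zero hz, hn, mulVar_apply, mul_comm]

lemma robertsD_X_xIdx (i : Fin 3) : robertsD k (X (xIdx i)) = 0 := by
  fin_cases i <;> simp [robertsD, xIdx]

lemma sumMulVar_invariants_le (c : ℤ) : sumMulVar (invariants k (c - 1)) ≤ invariants k c := by
  refine sumMulVar_le fun i p hp => ?_
  rw [mem_invariants] at *
  refine ⟨?_, mulVar_proj_eq i hp.2 (by ring)⟩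
  rw [mulVar_apply, Derivation.leibniz, hp.1, robertsD_X_xIdx, smul_zero, smul_zero, add_zero]

lemma invariants_le_sumMulVar [CharZero k] {c : ℤ} (hc : 1 < c) :
    invariants k c ≤ sumMulVar (invariants k (c - 1)) := by
  intro p hp
  obtain ⟨n, hn⟩ := exists_del_pow_eq_zero p
  induction n generalizing p with
  | zero =>
    rw [show p = 0 by simpa using hn]
    exact Submodule.zero_mem _
  | succ n ih =>
    have hp' := mem_invariants.mp hp
    have hz : del 6 ((del 6 ^ n) p) = 0 := by rw [← Module.End.mul_apply, ← pow_succ', hn]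
    have hg : (del 6 ^ n) p ∈ zFree k c := mem_zFree.mpr
      ⟨by rw [← robertsD_of_del_eq_zero hz, robertsD_del_pow n hp'.1], hz,
        del_pow_proj_eq hp'.2 n⟩
    have hle : sumMulVar (zFree k (c - 1)) ≤
        (sumMulVar (invariants k (c - 1))).map (del 6 ^ n) := by
      refine sumMulVar_le fun i u hu => ?_
      obtain ⟨v, hv, rfl⟩ := zFree_le_map_del_pow (by omega) n hu
      refine ⟨mulVar (xIdx i) v, mulVar_mem_sumMulVar i hv, ?_⟩
      rw [mulVar_apply, del_pow_mul_of_del_eq_zero, mulVar_apply]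
      exact pderiv_X_of_ne (xIdx_ne_z i)
    obtain ⟨q, hq, hqp⟩ := hle (zFree_le_sumMulVar (by omega) hg)
    rw [← sub_add_cancel p q]
    refine Submodule.add_mem _ (ih ?_ ?_) hq
    · exact Submodule.sub_mem _ hp (sumMulVar_invariants_le c hq)
    · rw [map_sub, hqp, sub_self]

end Invariants

section NotFiniteType

/-- The polynomials all of whose monomials have weight at least `n`. -/
def minWeight (k : Type*) [Field k] (n : ℤ) : Submodule k (Poly k) where
  carrier := {p | ∀ s, coeff s p ≠ 0 → n ≤ eWeight s}
  zero_mem' := fun s hs => absurd (coeff_zero s) hs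
  add_mem' := fun {p q} hp hq s hs => by
    by_cases h : coeff s p = 0
    · refine hq s fun h' => hs ?_
      rw [coeff_add, h, h', add_zero]
    · exact hp s h
  smul_mem' := fun a p hp s hs => hp s fun h => hs (by rw [coeff_smul, h, smul_zero])

lemma minWeight_mono {m n : ℤ} (h : m ≤ n) : minWeight k n ≤ minWeight k m :=
  fun _ hp s hs => h.trans (hp s hs)

lemma mul_mem_minWeight {l m n : ℤ} (h : l ≤ m + n) {p q : Poly k} (hp : p ∈ minWeight k m)
    (hq : q ∈ minWeight k n) : p * q ∈ minWeight k l := by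
  intro u hu
  obtain ⟨s, t, rfl, hs, ht⟩ := exists_of_coeff_mul_ne_zero hu
  rw [eWeight_add]
  exact h.trans (add_le_add (hp s hs) (hq t ht))

lemma proj_eq_zero_of_mem_minWeight {c n : ℤ} (h : c < n) {p : Poly k}
    (hp : p ∈ minWeight k n) : proj eWeight c p = 0 := by
  ext s
  rw [coeff_proj, coeff_zero]
  split_ifs with hs
  · by_contra h0
    exact (h.trans_le (hp s h0)).ne hs.symm
  · rfl

lemma proj_mem_minWeight (c : ℤ) (p : Poly k) : proj eWeight c p ∈ minWeight k c :=
  fun s hs => (proj_eq_self_iff.mp (proj_proj eWeight c p) s hs).ge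

lemma sub_proj_mem_minWeight {n : ℤ} {p : Poly k} (hp : p ∈ minWeight k n) :
    p - proj eWeight n p ∈ minWeight k (n + 1) := by
  intro s hs
  rw [coeff_sub, coeff_proj] at hs
  split_ifs at hs with h
  · exact absurd (sub_self _) hs
  · exact Int.add_one_le_iff.mpr ((hp s (by rwa [sub_zero] at hs)).lt_of_ne' h)

lemma proj_zero_mul {p q : Poly k} (hp : p ∈ minWeight k 0) (hq : q ∈ minWeight k 0) :
    proj eWeight 0 (p * q) = proj eWeight 0 p * proj eWeight 0 q := by
  have h : p * q = proj eWeight 0 p * proj eWeight 0 q + (proj eWeight 0 p *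
      (q - proj eWeight 0 q) + (p - proj eWeight 0 p) * q) := by ring
  conv_lhs => rw [h, map_add]
  rw [proj_eq_zero_of_mem_minWeight zero_lt_one (Submodule.add_mem _
    (mul_mem_minWeight (by norm_num) (proj_mem_minWeight 0 p) (sub_proj_mem_minWeight hq))
    (mul_mem_minWeight (by norm_num) (sub_proj_mem_minWeight hp) hq)), add_zero]
  exact mul_proj_eq (c := 0) (d := 0) (proj_proj _ _ _) (proj_proj _ _ _)

lemma sub_proj_sub_proj_mem_minWeight {p : Poly k} (hp : p ∈ minWeight k 0) :
    p - proj eWeight 0 p - proj eWeight 1 p ∈ minWeight k 2 := by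
  intro s hs
  rw [coeff_sub, coeff_sub, coeff_proj, coeff_proj] at hs
  have h := hp s
  split_ifs at hs with h0 h1 h1
  · omega
  · simp at hs
  · simp at hs
  · rw [sub_zero, sub_zero] at hs
    have := h hs
    omega

lemma proj_one_mul {p q : Poly k} (hp : p ∈ minWeight k 0) (hq : q ∈ minWeight k 0) :
    proj eWeight 1 (p * q) =
      proj eWeight 0 p * proj eWeight 1 q + proj eWeight 0 q * proj eWeight 1 p := by
  have h : p * q = proj eWeight 0 p * proj eWeight 0 q +
      (proj eWeight 0 p * proj eWeight 1 q + proj eWeight 0 q * proj eWeight 1 p) +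
      (proj eWeight 1 p * proj eWeight 1 q +
        ((p - proj eWeight 0 p - proj eWeight 1 p) * q +
          (proj eWeight 0 p + proj eWeight 1 p) *
            (q - proj eWeight 0 q - proj eWeight 1 q))) := by ring
  have h0 : proj eWeight 1 (proj eWeight 0 p * proj eWeight 0 q) = 0 := by
    rw [← mul_proj_eq (proj_proj eWeight 0 p) (proj_proj eWeight 0 q), proj_eq_zero_iff]
    intro s hs h1
    have := proj_eq_self_iff.mp (proj_proj _ _ _) s hs
    omega
  conv_lhs => rw [h, map_add, map_add, h0]
  have hp2 := sub_proj_sub_proj_mem_minWeight hp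
  have hq2 := sub_proj_sub_proj_mem_minWeight hq
  have h01 : proj eWeight 0 p + proj eWeight 1 p ∈ minWeight k 0 :=
    Submodule.add_mem _ (proj_mem_minWeight 0 p)
      (minWeight_mono zero_le_one (proj_mem_minWeight 1 p))
  rw [proj_eq_zero_of_mem_minWeight one_lt_two (Submodule.add_mem _
    (mul_mem_minWeight (by norm_num) (proj_mem_minWeight 1 p) (proj_mem_minWeight 1 q))
    (Submodule.add_mem _ (mul_mem_minWeight (by norm_num) hp2 hq)
      (mul_mem_minWeight (by norm_num) h01 hq2))), zero_add, add_zero, map_add]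
  congr 1
  · exact mul_proj_eq (c := 0) (d := 1) (proj_proj _ _ _) (proj_proj _ _ _)
  · exact mul_proj_eq (c := 0) (d := 1) (proj_proj _ _ _) (proj_proj _ _ _)

lemma mem_minWeight_of_robertsD_eq_zero [CharZero k] {p : Poly k} (hp : robertsD k p = 0) :
    p ∈ minWeight k 0 := by
  intro s hs
  by_contra h
  have := eq_zero_of_robertsD_eq_zero_of_neg (not_le.mp h) (robertsD_proj hp _) (proj_proj _ _ _)
  exact proj_eq_zero_iff.mp this s hs rfl

lemma del_proj_zero [CharZero k] {p : Poly k} (hp : robertsD k p = 0) :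
    del 6 (proj eWeight 0 p) = 0 :=
  del_eq_zero_of_robertsD_eq_zero (robertsD_proj hp 0) (proj_proj _ _ _)

lemma proj_zero_pow [CharZero k] {p : Poly k} (hp : robertsD k p = 0) (m : ℕ) :
    proj eWeight 0 (p ^ m) = proj eWeight 0 p ^ m := by
  induction m with
  | zero =>
    rw [pow_zero, pow_zero, proj_eq_self_iff]
    intro s hs
    rw [coeff_one, ite_ne_right_iff] at hs
    rw [← hs.1]
    rfl
  | succ m ih =>
    have h := mem_minWeight_of_robertsD_eq_zero (p := p ^ m) (by
      rw [Derivation.leibniz_pow, hp, smul_zero, smul_zero])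
    rw [pow_succ, proj_zero_mul h (mem_minWeight_of_robertsD_eq_zero hp), ih, pow_succ]

/-- The invariants whose component of weight `1` has degree less than `n` in `z`. -/
noncomputable def boundedInvariants (k : Type*) [Field k] [CharZero k] (n : ℕ) :
    Subalgebra k (robertsA k) where
  carrier := {a | (del 6 ^ n) (proj eWeight 1 (a : Poly k)) = 0}
  mul_mem' := fun {a b} (ha : _ = _) (hb : _ = _) => by
    show (del 6 ^ n) (proj eWeight 1 ((a : Poly k) * (b : Poly k))) = 0
    rw [proj_one_mul (mem_minWeight_of_robertsD_eq_zero a.2)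
      (mem_minWeight_of_robertsD_eq_zero b.2), map_add,
      del_pow_mul_of_del_eq_zero (del_proj_zero a.2), del_pow_mul_of_del_eq_zero
      (del_proj_zero b.2), ha, hb, mul_zero, mul_zero, add_zero]
  add_mem' := fun {a b} (ha : _ = _) (hb : _ = _) => by
    show (del 6 ^ n) (proj eWeight 1 ((a : Poly k) + (b : Poly k))) = 0
    rw [map_add, map_add, ha, hb, add_zero]
  algebraMap_mem' := fun c => by
    show (del 6 ^ n) (proj eWeight 1 (C c)) = 0
    rw [proj_eq_zero_iff.mpr, map_zero]
    intro s hs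
    rw [coeff_C, ite_ne_right_iff] at hs
    rw [← hs.1]
    exact zero_ne_one

lemma mem_boundedInvariants [CharZero k] {n : ℕ} {a : robertsA k} :
    a ∈ boundedInvariants k n ↔ (del 6 ^ n) (proj eWeight 1 (a : Poly k)) = 0 := Iff.rfl

lemma boundedInvariants_mono [CharZero k] : Monotone (boundedInvariants k) := by
  intro m n h a ha
  rw [mem_boundedInvariants] at *
  rw [← Nat.sub_add_cancel h, pow_add, Module.End.mul_apply, ha, map_zero]

lemma exists_mem_boundedInvariants [CharZero k] (a : robertsA k) :
    ∃ n, a ∈ boundedInvariants k n :=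
  exists_del_pow_eq_zero _

/-- If a ring is an increasing union of subalgebras and its localization at `f` is of finite type,
then some member of the union becomes everything after inverting `f`. -/
lemma exists_forall_mul_pow_mem {A : Type*} [CommRing A] [Algebra k A] (f : A)
    (S : ℕ → Subalgebra k A) (hS : Monotone S) (hA : ∀ a, ∃ n, a ∈ S n)
    (hft : Algebra.FiniteType k (Localization.Away f)) :
    ∃ n, ∀ a, ∃ m, a * f ^ m ∈ S n := by
  let P (n : ℕ) (x : Localization.Away f) : Prop :=
    ∃ m : ℕ, ∃ s ∈ S n, x * algebraMap A _ (f ^ m) = algebraMap A _ s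
  have hP {m n : ℕ} (h : m ≤ n) {x : Localization.Away f} : P m x → P n x :=
    fun ⟨l, s, hs, hx⟩ => ⟨l, s, hS h hs, hx⟩
  have hex (x : Localization.Away f) : ∃ n, P n x := by
    obtain ⟨m, s, hx⟩ := IsLocalization.Away.surj f x
    obtain ⟨n, hn⟩ := hA s
    exact ⟨n, m, s, hn, by rw [map_pow, hx]⟩
  choose N hN using hex
  obtain ⟨N₀, hN₀⟩ := hA f
  obtain ⟨t, ht⟩ := hft.1
  let n := max N₀ (t.sup N)
  have hf : f ∈ S n := hS (le_max_left _ _) hN₀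
  have hall (x : Localization.Away f) : P n x := by
    have hx : x ∈ Algebra.adjoin k (t : Set (Localization.Away f)) := ht ▸ Algebra.mem_top
    induction hx using Algebra.adjoin_induction with
    | mem x hx => exact hP ((Finset.le_sup hx).trans (le_max_right _ _)) (hN x)
    | algebraMap r =>
      refine ⟨0, algebraMap k A r, Subalgebra.algebraMap_mem _ r, ?_⟩
      rw [pow_zero, map_one, mul_one, ← IsScalarTower.algebraMap_apply]
    | add x y _ _ hx hy =>
      obtain ⟨l, s, hs, hx⟩ := hx
      obtain ⟨m, u, hu, hy⟩ := hy
      refine ⟨l + m, s * f ^ m + u * f ^ l, Subalgebra.add_mem _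
        (Subalgebra.mul_mem _ hs (Subalgebra.pow_mem _ hf m))
        (Subalgebra.mul_mem _ hu (Subalgebra.pow_mem _ hf l)), ?_⟩
      rw [map_add, map_mul, map_mul, ← hx, ← hy, pow_add, map_mul]
      ring
    | mul x y _ _ hx hy =>
      obtain ⟨l, s, hs, hx⟩ := hx
      obtain ⟨m, u, hu, hy⟩ := hy
      refine ⟨l + m, s * u, Subalgebra.mul_mem _ hs hu, ?_⟩
      rw [map_mul, ← hx, ← hy, pow_add, map_mul]
      ring
  refine ⟨n, fun a => ?_⟩
  obtain ⟨m, s, hs, h⟩ := hall (algebraMap A _ a)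
  rw [← map_mul] at h
  obtain ⟨⟨_, l, rfl⟩, hc⟩ := (IsLocalization.eq_iff_exists (Submonoid.powers f) _).mp h
  refine ⟨m + l, ?_⟩
  rw [pow_add, ← mul_assoc, mul_comm, show f ^ l * (a * f ^ m) = f ^ l * s from hc]
  exact Subalgebra.mul_mem _ (Subalgebra.pow_mem _ hf l) hs

lemma proj_zero_eq_zero_of_finiteType [CharZero k] (f : robertsA k)
    (hft : Algebra.FiniteType k (Localization.Away f)) : proj eWeight 0 (f : Poly k) = 0 := by
  obtain ⟨n, hn⟩ := exists_forall_mul_pow_mem f _ boundedInvariants_mono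
    exists_mem_boundedInvariants hft
  obtain ⟨β, hβ, hβx⟩ := exists_del_pow_eq_X (k := k) 0 n
  obtain ⟨hD, hw⟩ := mem_invariants.mp hβ
  obtain ⟨m, hm⟩ := hn ⟨β, hD⟩
  rw [mem_boundedInvariants] at hm
  have hf : robertsD k ((f : Poly k) ^ m) = 0 := (f ^ m).2
  have hβ0 : proj eWeight 0 β = 0 := by
    rw [proj_eq_zero_iff]
    intro s hs
    rw [proj_eq_self_iff.mp hw s hs]
    exact one_ne_zero
  rw [Subalgebra.coe_mul, Subalgebra.coe_pow, proj_one_mul (mem_minWeight_of_robertsD_eq_zero hD)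
    (mem_minWeight_of_robertsD_eq_zero hf), hβ0, zero_mul, zero_add, hw,
    del_pow_mul_of_del_eq_zero (del_proj_zero hf), hβx, proj_zero_pow f.2] at hm
  exact eq_zero_of_pow_eq_zero ((mul_eq_zero.mp hm).resolve_right (X_ne_zero _))

/-- The ideal of the invariant ring generated by the `xᵢ`. -/
noncomputable def xIdeal (k : Type*) [Field k] : Ideal (robertsA k) :=
  Ideal.span {robertsXvar k 0, robertsXvar k 1, robertsXvar k 2}

lemma coe_robertsXvar (i : Fin 3) : (robertsXvar k i : Poly k) = X (xIdx i) := rfl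

lemma robertsXvar_mem_xIdeal (i : Fin 3) : robertsXvar k i ∈ xIdeal k :=
  Ideal.subset_span (by fin_cases i <;> simp)

lemma mem_xIdeal_of_mem_minWeight [CharZero k] (a : robertsA k)
    (ha : (a : Poly k) ∈ minWeight k 2) : a ∈ xIdeal k := by
  let J : Submodule k (Poly k) :=
    ((xIdeal k).restrictScalars k).map (robertsA k).val.toLinearMap
  have hJ : (a : Poly k) ∈ J := by
    refine mem_of_proj_mem eWeight fun c => ?_
    by_cases hc : c < 2
    · rw [proj_eq_zero_of_mem_minWeight hc ha]
      exact Submodule.zero_mem _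
    have h := invariants_le_sumMulVar (by omega)
      (mem_invariants.mpr ⟨robertsD_proj a.2 c, proj_proj eWeight c (a : Poly k)⟩)
    refine sumMulVar_le (T := J) (fun i p hp => ?_) h
    have hb := Ideal.mul_mem_right ⟨p, (mem_invariants.mp hp).1⟩ _ (robertsXvar_mem_xIdeal i)
    refine Submodule.mem_map.mpr ⟨_, hb, ?_⟩
    rw [mulVar_apply, ← coe_robertsXvar]
    exact Subalgebra.coe_mul _ _ _
  obtain ⟨b, hb, h⟩ := Submodule.mem_map.mp hJ
  exact Subtype.ext h ▸ hb

lemma exists_pow_mem_xIdeal [CharZero k] (f : robertsA k)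
    (hft : Algebra.FiniteType k (Localization.Away f)) : ∃ n : ℕ, f ^ n ∈ xIdeal k := by
  refine ⟨2, mem_xIdeal_of_mem_minWeight _ ?_⟩
  have h := sub_proj_mem_minWeight (mem_minWeight_of_robertsD_eq_zero f.2)
  rw [proj_zero_eq_zero_of_finiteType f hft, sub_zero] at h
  rw [sq]
  exact mul_mem_minWeight (by norm_num) h h

end NotFiniteType

section FiniteType

lemma robertsD_robertsD_X (j : Fin 7) : robertsD k (robertsD k (X j)) = 0 := by
  fin_cases j <;> simp [robertsD, Derivation.leibniz_pow]

lemma robertsD_X_yIdx (i : Fin 3) : robertsD k (X (yIdx i)) = X (xIdx i) ^ 3 := by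
  fin_cases i <;> simp [robertsD, yIdx, xIdx]

/-- The additive group action `p ↦ exp(tD) p` on polynomials. -/
noncomputable def flow (k : Type*) [Field k] : Poly k →ₐ[k] Polynomial (Poly k) :=
  aeval fun j => Polynomial.C (X j) + Polynomial.X * Polynomial.C (robertsD k (X j))

lemma flow_X (j : Fin 7) :
    flow k (X j) = Polynomial.C (X j) + Polynomial.X * Polynomial.C (robertsD k (X j)) :=
  aeval_X _ _

lemma flow_robertsD_X (j : Fin 7) :
    flow k (robertsD k (X j)) = Polynomial.C (robertsD k (X j)) := by
  fin_cases j <;> simp [robertsD, flow]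

lemma derivative_flow (p : Poly k) :
    Polynomial.derivative (flow k p) = flow k (robertsD k p) := by
  induction p using MvPolynomial.induction_on with
  | C a => simp [flow, IsScalarTower.algebraMap_apply k (Poly k) (Polynomial (Poly k))]
  | add p q hp hq => simp only [map_add, hp, hq]
  | mul_X p j hp =>
    rw [map_mul, Polynomial.derivative_mul, hp, Derivation.leibniz, map_add, smul_eq_mul,
      smul_eq_mul, map_mul, map_mul, flow_robertsD_X, flow_X]
    simp only [Polynomial.derivative_add, Polynomial.derivative_mul, Polynomial.derivative_C,
      Polynomial.derivative_X]
    ring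

lemma eval_zero_flow (p : Poly k) : Polynomial.eval 0 (flow k p) = p := by
  induction p using MvPolynomial.induction_on with
  | C a => simp [flow, IsScalarTower.algebraMap_apply k (Poly k) (Polynomial (Poly k))]
  | add p q hp hq => simp only [map_add, Polynomial.eval_add, hp, hq]
  | mul_X p j hp => simp [Polynomial.eval_mul, hp, flow_X]

lemma flow_of_robertsD_eq_zero [CharZero k] {p : Poly k} (hp : robertsD k p = 0) :
    flow k p = Polynomial.C p := by
  have h := Polynomial.eq_C_of_natDegree_eq_zero
    (Polynomial.derivative_eq_zero (p := flow k p) |>.mp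
      (by rw [derivative_flow, hp, map_zero]))
  have h0 := eval_zero_flow p
  rw [h, Polynomial.eval_C] at h0
  rw [h, h0]

/-- The invariant `xᵢ³ v - yᵢ D(v)`, where `v` is the `j`-th variable. -/
noncomputable def slice (k : Type*) [Field k] (i : Fin 3) (j : Fin 7) : robertsA k :=
  ⟨X (xIdx i) ^ 3 * X j - X (yIdx i) * robertsD k (X j), by
    show robertsD k _ = 0
    rw [map_sub, Derivation.leibniz, Derivation.leibniz, Derivation.leibniz_pow, robertsD_X_xIdx,
      robertsD_robertsD_X, robertsD_X_yIdx]
    simp only [smul_eq_mul, smul_zero, mul_zero, add_zero, zero_add]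
    ring⟩

lemma coe_slice (i : Fin 3) (j : Fin 7) :
    (slice k i j : Poly k) = X (xIdx i) ^ 3 * X j - X (yIdx i) * robertsD k (X j) := rfl

/-- The invariants which generate the invariant ring after inverting `xᵢ`. -/
def localGenerators (k : Type*) [Field k] (i : Fin 3) : Set (robertsA k) :=
  insert (robertsXvar k i) (Set.range (slice k i))

lemma localGenerators_finite (i : Fin 3) : (localGenerators k i).Finite :=
  (Set.finite_range _).insert _

lemma aeval_slice_div [CharZero k] (i : Fin 3) {p : Poly k} (hp : robertsD k p = 0) :
    aeval (fun j => algebraMap (Poly k) (FractionRing (Poly k)) (slice k i j) /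
      algebraMap (Poly k) (FractionRing (Poly k)) (X (xIdx i) ^ 3)) p =
      algebraMap (Poly k) (FractionRing (Poly k)) p := by
  let K := FractionRing (Poly k)
  have hx : algebraMap (Poly k) K (X (xIdx i) ^ 3) ≠ 0 := by
    rw [Ne, FaithfulSMul.algebraMap_eq_zero_iff]
    exact pow_ne_zero _ (X_ne_zero _)
  let t : K := -(algebraMap (Poly k) K (X (yIdx i)) / algebraMap (Poly k) K (X (xIdx i) ^ 3))
  have h : aeval (fun j => algebraMap (Poly k) K (slice k i j) /
      algebraMap (Poly k) K (X (xIdx i) ^ 3)) =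
      ((Polynomial.aeval t).restrictScalars k).comp (flow k) := by
    ext j
    rw [aeval_X, AlgHom.comp_apply, flow_X, coe_slice, AlgHom.restrictScalars_apply, map_add,
      map_mul, Polynomial.aeval_C, Polynomial.aeval_C, Polynomial.aeval_X, map_sub, map_mul,
      map_mul, sub_div, mul_div_cancel_left₀ _ hx]
    simp only [t]
    ring
  have := DFunLike.congr_fun h p
  rwa [AlgHom.comp_apply, flow_of_robertsD_eq_zero hp, AlgHom.restrictScalars_apply,
    Polynomial.aeval_C] at this

lemma exists_pow_mul_mem_adjoin [CharZero k] (i : Fin 3) (a : robertsA k) :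
    ∃ m, robertsXvar k i ^ m * a ∈ Algebra.adjoin k (localGenerators k i) := by
  let K := FractionRing (Poly k)
  let S := Algebra.adjoin k (localGenerators k i)
  let v : Fin 7 → K := fun j => algebraMap (Poly k) K (slice k i j) /
    algebraMap (Poly k) K (X (xIdx i) ^ 3)
  let x : K := algebraMap (Poly k) K (X (xIdx i))
  have hxS : robertsXvar k i ∈ S := Algebra.subset_adjoin (Set.mem_insert _ _)
  have hx : x ≠ 0 := by
    rw [Ne, FaithfulSMul.algebraMap_eq_zero_iff]
    exact X_ne_zero _
  have hxA : algebraMap (Poly k) K (robertsXvar k i) = x := rfl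
  have key (p : Poly k) : ∃ m : ℕ, ∃ b ∈ S, x ^ m * aeval v p = algebraMap (Poly k) K b := by
    induction p using MvPolynomial.induction_on with
    | C c =>
      refine ⟨0, algebraMap k _ c, Subalgebra.algebraMap_mem _ c, ?_⟩
      rw [pow_zero, one_mul, algHom_C]
      exact IsScalarTower.algebraMap_apply k (Poly k) K c
    | add p q hp hq =>
      obtain ⟨l, b, hb, hp⟩ := hp
      obtain ⟨m, c, hc, hq⟩ := hq
      refine ⟨l + m, robertsXvar k i ^ m * b + robertsXvar k i ^ l * c, Subalgebra.add_mem _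
        (Subalgebra.mul_mem _ (Subalgebra.pow_mem _ hxS m) hb)
        (Subalgebra.mul_mem _ (Subalgebra.pow_mem _ hxS l) hc), ?_⟩
      simp only [Subalgebra.coe_add, Subalgebra.coe_mul, Subalgebra.coe_pow, map_add, map_mul,
        map_pow, hxA, ← hp, ← hq]
      ring
    | mul_X p j hp =>
      obtain ⟨m, b, hb, hp⟩ := hp
      refine ⟨m + 3, b * slice k i j, Subalgebra.mul_mem _ hb
        (Algebra.subset_adjoin (Set.mem_insert_of_mem _ ⟨j, rfl⟩)), ?_⟩
      rw [Subalgebra.coe_mul, map_mul, map_mul, ← hp, aeval_X]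
      have hv : x ^ 3 * v j = algebraMap (Poly k) K (slice k i j) := by
        rw [← map_pow]
        exact mul_div_cancel₀ _ (by rw [map_pow]; exact pow_ne_zero 3 hx)
      rw [← hv]
      ring
  obtain ⟨m, b, hb, h⟩ := key a
  refine ⟨m, ?_⟩
  rw [aeval_slice_div i a.2] at h
  have : robertsXvar k i ^ m * a = b := by
    refine Subtype.ext (FaithfulSMul.algebraMap_injective (Poly k) K ?_)
    rw [← h, Subalgebra.coe_mul, map_mul, Subalgebra.coe_pow, map_pow, hxA]
  rwa [this]

/-- If a power of `f` lies in the ideal generated by elements `x i` such that each localization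
at `x i` is of finite type, then the localization at `f` is of finite type. -/
lemma finiteType_away_of_pow_mem_span {A ι : Type*} [CommRing A] [Algebra k A] [Fintype ι]
    (f : A) (x : ι → A) (S : ι → Set A) (hS : ∀ i, (S i).Finite)
    (hxS : ∀ i a, ∃ m, x i ^ m * a ∈ Algebra.adjoin k (S i)) {n : ℕ}
    (hf : f ^ n ∈ Ideal.span (Set.range x)) : Algebra.FiniteType k (Localization.Away f) := by
  obtain ⟨c, hc⟩ := Ideal.mem_span_range_iff_exists_fun.mp hf
  let φ : A →ₐ[k] Localization.Away f := IsScalarTower.toAlgHom k A _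
  let G : Set A := (⋃ i, S i) ∪ (Set.range x ∪ Set.range c)
  let e : Localization.Away f := IsLocalization.Away.invSelf f
  let T := Algebra.adjoin k (insert e (φ '' G))
  have hG (a : A) (ha : a ∈ G) : φ a ∈ T :=
    Algebra.subset_adjoin (Set.mem_insert_of_mem _ (Set.mem_image_of_mem _ ha))
  have he : e ∈ T := Algebra.subset_adjoin (Set.mem_insert _ _)
  have hfe : φ f * e = 1 := IsLocalization.Away.mul_invSelf f
  have hA (a : A) : φ a ∈ T := by
    refine T.mem_of_finsetSum_eq_one_of_pow_smul_mem Finset.univ (fun i => φ (x i))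
      (fun i => e ^ n * φ (c i)) ?_ (fun i => hG _ (.inr (.inl ⟨i, rfl⟩)))
      (fun i => T.mul_mem (T.pow_mem he n) (hG _ (.inr (.inr ⟨i, rfl⟩)))) _ fun i => ?_
    · simp only [mul_assoc, ← Finset.mul_sum, ← map_mul, ← map_sum]
      rw [hc, map_pow, ← mul_pow, mul_comm, hfe, one_pow]
    · obtain ⟨m, hm⟩ := hxS i a
      refine ⟨m, ?_⟩
      rw [smul_eq_mul, ← map_pow, ← map_mul]
      have h : (Algebra.adjoin k (S i)).map φ ≤ T := by
        rw [AlgHom.map_adjoin]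
        refine Algebra.adjoin_mono ((Set.image_mono ?_).trans (Set.subset_insert _ _))
        exact (Set.subset_iUnion S i).trans Set.subset_union_left
      exact h ⟨_, hm, rfl⟩
  have hT : T = ⊤ := by
    refine eq_top_iff.mpr fun y _ => ?_
    obtain ⟨m, a, h⟩ := IsLocalization.Away.surj f y
    have : y = φ a * e ^ m := by
      rw [show φ a = y * φ f ^ m from h.symm, mul_assoc, ← mul_pow, hfe, one_pow, mul_one]
    rw [this]
    exact T.mul_mem (hA a) (T.pow_mem he m)
  have hfin : (insert e (φ '' G)).Finite :=
    (((Set.finite_iUnion hS).union ((Set.finite_range x).union (Set.finite_range c))).image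
      φ).insert e
  exact ⟨Subalgebra.fg_def.mpr ⟨_, hfin, hT⟩⟩

lemma finiteType_of_pow_mem_xIdeal [CharZero k] {f : robertsA k} {n : ℕ}
    (hf : f ^ n ∈ xIdeal k) : Algebra.FiniteType k (Localization.Away f) := by
  refine finiteType_away_of_pow_mem_span f (robertsXvar k) (localGenerators k)
    localGenerators_finite exists_pow_mul_mem_adjoin (n := n) (Ideal.span_le.mpr ?_ hf)
  rintro _ (rfl | rfl | rfl) <;> exact Ideal.subset_span ⟨_, rfl⟩

end FiniteType

end Roberts

/-- The finite generation ideal of the invariant ring `A` of Roberts' action equals the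
radical of `(x₁, x₂, x₃)A`: for nonzero `f ∈ A`, the localization `A_f` is a finitely
generated `k`-algebra iff some power of `f` lies in `x₁A + x₂A + x₃A`. -/
theorem stmt_17 (k : Type*) [Field k] [CharZero k] (f : robertsA k) (hf : f ≠ 0) :
    Algebra.FiniteType k (Localization.Away f) ↔
      ∃ n : ℕ, f ^ n ∈ Ideal.span {robertsXvar k 0, robertsXvar k 1, robertsXvar k 2} := by
  exact ⟨Roberts.exists_pow_mem_xIdeal f, fun ⟨_, hn⟩ => Roberts.finiteType_of_pow_mem_xIdeal hn⟩
end

section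
/- Let k be a field of characteristic 0, R = k[x₁, x₂, x₃, y₁, y₂, y₃, z], and D the k-derivation of R with D(x_i) = 0, D(y_i) = x_i³ for i = 1,2,3, and D(z) = (x₁x₂x₃)². Then the kernel A = ker D = {f ∈ R : D(f) = 0} is not a finitely generated k-algebra (Roberts' counterexample to Hilbert's fourteenth problem). -/
open MvPolynomial

section LoweringRaising

variable {σ : Type*} (k : Type*) [Field k]

/-- The homogeneous polynomials of degree `j` whose degree in each variable `i` is at most `d i`. -/
noncomputable def boundedHomogeneous (d : σ → ℕ) (j : ℕ) : Submodule k (MvPolynomial σ k) :=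
  restrictSupport k {b | b.degree = j ∧ ∀ i, b i ≤ d i}

/-- The derivation `∑ i, ∂ / ∂ X i`. -/
noncomputable def sumPartials (σ : Type*) :
    Derivation k (MvPolynomial σ k) (MvPolynomial σ k) :=
  mkDerivation k fun _ => 1

/-- The operator `∑ i, (d i * X i - X i ^ 2 * ∂ / ∂ X i)`. -/
noncomputable def raising [Fintype σ] (d : σ → ℕ) : Module.End k (MvPolynomial σ k) :=
  LinearMap.mulLeft k (∑ i, C (d i : k) * X i) - (mkDerivation k fun i => X i ^ 2).toLinearMap

variable {k} {d : σ → ℕ} {j : ℕ} {p : MvPolynomial σ k}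

lemma boundedHomogeneous_induction {M : Submodule k (MvPolynomial σ k)}
    (hM : ∀ b : σ →₀ ℕ, b.degree = j → (∀ i, b i ≤ d i) → monomial b 1 ∈ M)
    (hp : p ∈ boundedHomogeneous k d j) : p ∈ M := by
  rw [boundedHomogeneous, restrictSupport_eq_span] at hp
  refine Submodule.span_le.2 ?_ hp
  rintro _ ⟨b, hb, rfl⟩
  exact hM b hb.1 hb.2

lemma monomial_mem_boundedHomogeneous {b : σ →₀ ℕ} (r : k) (hj : b.degree = j)
    (hb : ∀ i, b i ≤ d i) : monomial b r ∈ boundedHomogeneous k d j :=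
  (monomial_mem_restrictSupport k).2 (Or.inl ⟨hj, hb⟩)

lemma boundedHomogeneous_mono {d' : σ → ℕ} (h : d ≤ d') :
    boundedHomogeneous k d j ≤ boundedHomogeneous k d' j :=
  restrictSupport_mono _ fun _ hb => ⟨hb.1, fun i => (hb.2 i).trans (h i)⟩

lemma sumPartials_eq_zero (hp : p ∈ boundedHomogeneous k d 0) : sumPartials k σ p = 0 := by
  refine boundedHomogeneous_induction (M := LinearMap.ker (sumPartials k σ).toLinearMap)
    (fun b hb _ => ?_) hp
  obtain rfl : b = 0 := (Finsupp.degree_eq_zero_iff b).1 hb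
  simp [sumPartials]

lemma sumPartials_mem (hp : p ∈ boundedHomogeneous k d (j + 1)) :
    sumPartials k σ p ∈ boundedHomogeneous k d j := by
  classical
  refine boundedHomogeneous_induction
    (M := (boundedHomogeneous k d j).comap (sumPartials k σ).toLinearMap) (fun b hj hb => ?_) hp
  simp only [Submodule.mem_comap, Derivation.coeFn_coe, sumPartials,
    mkDerivation_monomial, one_smul, smul_eq_mul, mul_one]
  refine Submodule.sum_mem _ fun i hi => ?_
  have hi' : Finsupp.single i 1 ≤ b := by
    simpa [Nat.one_le_iff_ne_zero] using hi
  refine monomial_mem_boundedHomogeneous _ ?_ fun l => (Nat.sub_le _ _).trans (hb l)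
  have := congrArg Finsupp.degree (tsub_add_cancel_of_le hi')
  simp only [map_add, Finsupp.degree_single] at this
  omega

variable [Fintype σ]

lemma mkDerivation_apply_eq_sum (v : σ → MvPolynomial σ k) :
    mkDerivation k v p = ∑ i, v i * pderiv i p := by
  classical
  have h : mkDerivation k v = ∑ i, v i • pderiv i := by
    ext1 l
    rw [← Derivation.coeFnAddMonoidHom_apply (∑ i, v i • pderiv i), map_sum]
    simp [pderiv_X, Pi.single_apply]
  rw [h, ← Derivation.coeFnAddMonoidHom_apply, map_sum]
  simp

lemma raising_mem (hp : p ∈ boundedHomogeneous k d j) :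
    raising k d p ∈ boundedHomogeneous k d (j + 1) := by
  classical
  refine boundedHomogeneous_induction
    (M := (boundedHomogeneous k d (j + 1)).comap (raising k d)) (fun b hj hb => ?_) hp
  have key : raising k d (monomial b 1) =
      ∑ i, monomial (b + Finsupp.single i 1) ((d i : k) - b i) := by
    simp only [raising, LinearMap.sub_apply, LinearMap.mulLeft_apply, Finset.sum_mul,
      Derivation.coeFn_coe, mkDerivation_monomial, one_smul, smul_eq_mul]
    rw [Finsupp.sum_fintype _ _ (by simp), ← Finset.sum_sub_distrib]
    refine Finset.sum_congr rfl fun i _ => ?_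
    rw [map_sub]
    congr 1
    · rw [X, C_mul_monomial, monomial_mul, add_comm]
      simp
    · rw [X_pow_eq_monomial, monomial_mul]
      rcases Nat.eq_zero_or_pos (b i) with h | h
      · simp [h]
      · congr 2
        ext l
        by_cases hl : l = i
        · subst hl; simp; omega
        · simp [Ne.symm hl]
        simp
  rw [Submodule.mem_comap, key]
  refine Submodule.sum_mem _ fun i _ => ?_
  rcases (hb i).eq_or_lt with h | h
  · simp [h]
  · refine monomial_mem_boundedHomogeneous _ (by simp [hj]) fun l => ?_
    by_cases hl : l = i
    · subst hl; simpa using h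
    · simpa [Finsupp.single_apply, Ne.symm hl] using hb l

lemma sumPartials_raising (hp : p ∈ boundedHomogeneous k d j) :
    sumPartials k σ (raising k d p) =
      raising k d (sumPartials k σ p) + ((∑ i, (d i : k)) - 2 * j) • p := by
  have hbr : ⁅sumPartials k σ, mkDerivation k fun i : σ => (X i : MvPolynomial σ k) ^ 2⁆ =
      (2 : k) • mkDerivation k fun i : σ => (X i : MvPolynomial σ k) := by
    ext1 i
    simp [Derivation.commutator_apply, sumPartials, Derivation.leibniz_pow, two_smul]
  have hEuler : (mkDerivation k fun i : σ => (X i : MvPolynomial σ k)) p = (j : k) • p := by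
    have hhom : p.IsHomogeneous j := by
      refine boundedHomogeneous_induction (M := homogeneousSubmodule σ k j) (fun b hj _ => ?_) hp
      exact isHomogeneous_monomial _ hj
    rw [mkDerivation_apply_eq_sum, hhom.sum_X_mul_pderiv, Nat.cast_smul_eq_nsmul]
  have h := congrArg (fun D => D p) hbr
  simp only [Derivation.commutator_apply, Derivation.smul_apply, hEuler] at h
  have hs : sumPartials k σ (∑ i, C (d i : k) * X i) = C (∑ i, (d i : k)) := by
    simp [sumPartials]
  simp only [raising, LinearMap.sub_apply, LinearMap.mulLeft_apply, map_sub, Derivation.leibniz, hs,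
    Derivation.coeFn_coe, smul_eq_mul]
  rw [sub_eq_iff_eq_add] at h
  rw [h]
  simp only [smul_eq_C_mul, map_sub, map_mul]
  ring

lemma raising_iterate_mem (i : ℕ) (hp : p ∈ boundedHomogeneous k d j) :
    (raising k d)^[i] p ∈ boundedHomogeneous k d (j + i) := by
  induction i with
  | zero => exact hp
  | succ i ih => rw [Function.iterate_succ_apply', ← add_assoc]; exact raising_mem ih

lemma sumPartials_raising_iterate (i : ℕ) (hp : p ∈ boundedHomogeneous k d j) :
    sumPartials k σ ((raising k d)^[i + 1] p) = (raising k d)^[i + 1] (sumPartials k σ p) +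
      ((i + 1) * ((∑ l, (d l : k)) - 2 * j - i)) • (raising k d)^[i] p := by
  induction i with
  | zero => simpa using sumPartials_raising hp
  | succ i ih =>
    rw [Function.iterate_succ_apply', sumPartials_raising (raising_iterate_mem (i + 1) hp), ih,
      map_add, map_smul, ← Function.iterate_succ_apply' (raising k d),
      ← Function.iterate_succ_apply' (raising k d), add_assoc, ← add_smul]
    congr 2
    push_cast
    ring

lemma exists_sumPartials_eq_raising_iterate [CharZero k] {j : ℕ}
    {p : MvPolynomial σ k} (i : ℕ) (hd : 2 * j + i < ∑ l, d l)
    (hp : p ∈ boundedHomogeneous k d j) :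
    ∃ q ∈ boundedHomogeneous k d (j + i + 1), sumPartials k σ q = (raising k d)^[i] p := by
  have hc : ((i + 1) * ((∑ l, (d l : k)) - 2 * j - i)) ≠ 0 := by
    refine mul_ne_zero (by exact_mod_cast i.succ_ne_zero) ?_
    rw [sub_sub, sub_ne_zero]
    exact_mod_cast hd.ne'
  suffices ∃ q ∈ boundedHomogeneous k d (j + i + 1),
      sumPartials k σ q = (raising k d)^[i + 1] (sumPartials k σ p) by
    obtain ⟨q, hq, hqp⟩ := this
    refine ⟨((i + 1) * ((∑ l, (d l : k)) - 2 * j - i))⁻¹ • ((raising k d)^[i + 1] p - q),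
      Submodule.smul_mem _ _ (Submodule.sub_mem _ (raising_iterate_mem (i + 1) hp) hq), ?_⟩
    rw [Derivation.map_smul, map_sub, sumPartials_raising_iterate i hp, hqp, add_sub_cancel_left,
      inv_smul_smul₀ hc]
  cases j with
  | zero =>
    refine ⟨0, Submodule.zero_mem _, ?_⟩
    rw [sumPartials_eq_zero hp, map_zero, iterate_map_zero]
  | succ j =>
    rw [show j + 1 + i + 1 = j + (i + 1) + 1 by omega]
    exact exists_sumPartials_eq_raising_iterate (i + 1) (by omega) (sumPartials_mem hp)

end LoweringRaising

section RobertsSequence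

variable {k : Type*} [Field k]

/-- Upper bounds for the degrees of the degree `m` homogeneous polynomials `p` in three variables
`sᵢ` for which `x₁ (x₁x₂x₃)²ᵐ p(y₁/x₁³, y₂/x₂³, y₃/x₃³)` is a polynomial. -/
def robertsBound (m : ℕ) : Fin 3 → ℕ := ![(2 * m + 1) / 3, 2 * m / 3, 2 * m / 3]

lemma exists_sumPartials_eq_of_mem_robertsBound [CharZero k] {m : ℕ} {p : MvPolynomial (Fin 3) k}
    (hp : p ∈ boundedHomogeneous k (robertsBound m) m) :
    ∃ q ∈ boundedHomogeneous k (robertsBound (m + 1)) (m + 1), sumPartials k (Fin 3) q = p := by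
  have hle : robertsBound m ≤ robertsBound (m + 1) := by
    intro i
    fin_cases i <;> simp [robertsBound] <;> omega
  refine exists_sumPartials_eq_raising_iterate 0 ?_ (boundedHomogeneous_mono hle hp)
  simp only [robertsBound, Fin.sum_univ_three, Matrix.cons_val]
  omega

/-- The elements `(x₁x₂x₃)³ yᵢ / xᵢ³`. -/
noncomputable def robertsY (k : Type*) [CommRing k] : Fin 3 → MvPolynomial (Fin 7) k :=
  ![(X 1 * X 2) ^ 3 * X 3, (X 0 * X 2) ^ 3 * X 4, (X 0 * X 1) ^ 3 * X 5]

lemma robertsD_aeval_robertsY (p : MvPolynomial (Fin 3) k) :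
    robertsD k (aeval (robertsY k) p) =
      (X 0 * X 1 * X 2) ^ 3 * aeval (robertsY k) (sumPartials k (Fin 3) p) := by
  induction p using MvPolynomial.induction_on with
  | C a => simp [sumPartials]
  | add p q hp hq => simp only [map_add, hp, hq, mul_add]
  | mul_X p i hp =>
    have hY : robertsD k (robertsY k i) = (X 0 * X 1 * X 2) ^ 3 := by
      fin_cases i <;>
        simp [robertsD, robertsY, Derivation.leibniz, Derivation.leibniz_pow] <;> ring
    have hX : sumPartials k (Fin 3) (X i) = 1 := mkDerivation_X ..
    simp only [map_mul, aeval_X, Derivation.leibniz, hp, hY, hX, smul_eq_mul, map_add, map_one]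
    ring

lemma prod_pow_mul_monomial_eq {S : Type*} [CommRing S] (x₀ x₁ x₂ y₀ y₁ y₂ : S)
    {a₀ a₁ a₂ b₀ b₁ b₂ : ℕ}
    (h₀ : a₀ + b₀ = 2 * b₁ + 2 * b₂ + 1) (h₁ : a₁ + b₁ = 2 * b₀ + 2 * b₂)
    (h₂ : a₂ + b₂ = 2 * b₀ + 2 * b₁) :
    (x₀ * x₁ * x₂) ^ (b₀ + b₁ + b₂) *
        (x₀ ^ a₀ * x₁ ^ a₁ * x₂ ^ a₂ * (y₀ ^ b₀ * y₁ ^ b₁ * y₂ ^ b₂)) =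
      x₀ * (((x₁ * x₂) ^ 3 * y₀) ^ b₀ * ((x₀ * x₂) ^ 3 * y₁) ^ b₁ * ((x₀ * x₁) ^ 3 * y₂) ^ b₂) := by
  have e₀ : b₀ + b₁ + b₂ + a₀ = 1 + 3 * b₁ + 3 * b₂ := by omega
  have e₁ : b₀ + b₁ + b₂ + a₁ = 3 * b₀ + 3 * b₂ := by omega
  have e₂ : b₀ + b₁ + b₂ + a₂ = 3 * b₀ + 3 * b₁ := by omega
  calc
    _ = x₀ ^ (b₀ + b₁ + b₂ + a₀) * x₁ ^ (b₀ + b₁ + b₂ + a₁) * x₂ ^ (b₀ + b₁ + b₂ + a₂) *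
        (y₀ ^ b₀ * y₁ ^ b₁ * y₂ ^ b₂) := by ring
    _ = _ := by rw [e₀, e₁, e₂]; ring

lemma exists_mul_eq_aeval_robertsY {m : ℕ} {p : MvPolynomial (Fin 3) k}
    (hp : p ∈ boundedHomogeneous k (robertsBound m) m) :
    ∃ g ∈ restrictSupport k {e : Fin 7 →₀ ℕ | e 6 = 0},
      (X 0 * X 1 * X 2) ^ m * g = X 0 * aeval (robertsY k) p := by
  have h := boundedHomogeneous_induction
    (M := ((restrictSupport k {e : Fin 7 →₀ ℕ | e 6 = 0}).map
      (LinearMap.mulLeft k ((X 0 * X 1 * X 2) ^ m))).comap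
      (LinearMap.mulLeft k (X 0) ∘ₗ (aeval (robertsY k)).toLinearMap)) (fun b hj hb => ?_) hp
  · exact h
  · have hb₀ := hb 0
    have hb₁ := hb 1
    have hb₂ := hb 2
    simp only [robertsBound, Matrix.cons_val] at hb₀ hb₁ hb₂
    have hm : b 0 + b 1 + b 2 = m := by
      rw [← hj, Finsupp.degree_eq_sum, Fin.sum_univ_three]
    refine ⟨X 0 ^ (2 * m + 1 - 3 * b 0) * X 1 ^ (2 * m - 3 * b 1) * X 2 ^ (2 * m - 3 * b 2) *
      (X 3 ^ b 0 * X 4 ^ b 1 * X 5 ^ b 2), ?_, ?_⟩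
    · simp only [X_pow_eq_monomial, monomial_mul]
      exact (monomial_mem_restrictSupport k).2 (Or.inl (by simp))
    · simp only [LinearMap.mulLeft_apply, LinearMap.comp_apply, AlgHom.toLinearMap_apply,
        aeval_monomial, Finsupp.prod_fintype _ _ fun _ => pow_zero _, Fin.prod_univ_three, map_one,
        one_mul, robertsY, Matrix.cons_val, ← hm]
      exact prod_pow_mul_monomial_eq _ _ _ _ _ _ (by omega) (by omega) (by omega)

lemma exists_sumPartials_sequence (k : Type*) [Field k] [CharZero k] :
    ∃ H : ℕ → MvPolynomial (Fin 3) k, H 0 = 1 ∧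
      (∀ m, H m ∈ boundedHomogeneous k (robertsBound m) m) ∧
      ∀ m, sumPartials k (Fin 3) (H (m + 1)) = H m := by
  choose! next hnext using fun m (p : MvPolynomial (Fin 3) k) =>
    exists_sumPartials_eq_of_mem_robertsBound (k := k) (m := m) (p := p)
  let H : ℕ → MvPolynomial (Fin 3) k := fun m => Nat.rec 1 next m
  have hH : ∀ m, H m ∈ boundedHomogeneous k (robertsBound m) m := by
    intro m
    induction m with
    | zero => exact monomial_mem_boundedHomogeneous 1 (map_zero _) fun _ => Nat.zero_le _
    | succ m ih => exact (hnext m _ ih).1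
  exact ⟨H, rfl, hH, fun m => (hnext m _ (hH m)).2⟩

lemma exists_robertsD_sequence (k : Type*) [Field k] [CharZero k] :
    ∃ g : ℕ → MvPolynomial (Fin 7) k, g 0 = X 0 ∧
      (∀ m, g m ∈ restrictSupport k {e : Fin 7 →₀ ℕ | e 6 = 0}) ∧
      ∀ m, robertsD k (g (m + 1)) = (X 0 * X 1 * X 2) ^ 2 * g m := by
  obtain ⟨H, hH0, hH, hsum⟩ := exists_sumPartials_sequence k
  choose g hg hgH using fun m => exists_mul_eq_aeval_robertsY (hH m)
  refine ⟨g, by simpa [hH0] using hgH 0, hg, fun m => ?_⟩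
  have hD : ∀ n : ℕ, robertsD k ((X 0 * X 1 * X 2) ^ n) = 0 := fun n => by
    simp [robertsD, Derivation.leibniz, Derivation.leibniz_pow]
  have hD0 : robertsD k (X 0) = 0 := by simp [robertsD]
  have hne : (X 0 * X 1 * X 2 : MvPolynomial (Fin 7) k) ^ (m + 1) ≠ 0 :=
    pow_ne_zero _ (mul_ne_zero (mul_ne_zero (X_ne_zero _) (X_ne_zero _)) (X_ne_zero _))
  apply mul_left_cancel₀ hne
  have h := congrArg (robertsD k) (hgH (m + 1))
  rw [Derivation.leibniz, Derivation.leibniz, hD, hD0, smul_zero, smul_zero, add_zero, add_zero,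
    robertsD_aeval_robertsY, hsum, smul_eq_mul, smul_eq_mul] at h
  rw [h]
  linear_combination -(X 0 * X 1 * X 2) ^ 3 * hgH m

end RobertsSequence

/-- `D` vanishes on the convolution of `a` and `w` when `D` shifts both, with opposite signs. -/
lemma Derivation.sum_antidiagonal_eq_zero {k R : Type*} [CommRing k] [CommRing R] [Algebra k R]
    (D : Derivation k R R) {a w : ℕ → R} {c : R} (ha₀ : D (a 0) = 0) (hw₀ : D (w 0) = 0)
    (ha : ∀ m, D (a (m + 1)) = -(c * a m)) (hw : ∀ m, D (w (m + 1)) = c * w m) (n : ℕ) :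
    D (∑ q ∈ Finset.HasAntidiagonal.antidiagonal n, a q.1 * w q.2) = 0 := by
  simp only [map_sum, D.leibniz, Finset.sum_add_distrib, smul_eq_mul]
  cases n with
  | zero => simp [ha₀, hw₀]
  | succ n =>
    rw [Finset.Nat.sum_antidiagonal_succ', Finset.Nat.sum_antidiagonal_succ]
    simp only [ha₀, hw₀, ha, hw, mul_zero, zero_add]
    rw [← Finset.sum_add_distrib]
    exact Finset.sum_eq_zero fun q _ => by ring

section NotFinitelyGenerated

variable {k : Type*} [Field k]

lemma exists_mem_robertsA_coeff_ne_zero (k : Type*) [Field k] [CharZero k] (n : ℕ) :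
    ∃ f ∈ robertsA k, coeff (Finsupp.single 0 1 + Finsupp.single 6 n) f ≠ 0 := by
  obtain ⟨g, hg0, hg, hDg⟩ := exists_robertsD_sequence k
  refine ⟨∑ q ∈ Finset.HasAntidiagonal.antidiagonal n,
    (-1) ^ q.1 * g q.1 * monomial (Finsupp.single 6 q.2) ((q.2.factorial : k)⁻¹), ?_, ?_⟩
  · refine (robertsD k).sum_antidiagonal_eq_zero (a := fun i => (-1) ^ i * g i)
      (w := fun j => monomial (Finsupp.single 6 j) ((j.factorial : k)⁻¹))
      (c := (X 0 * X 1 * X 2) ^ 2) ?_ ?_ (fun m => ?_) (fun m => ?_) n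
    · simp [hg0, robertsD]
    · simp [robertsD]
    · simp [Derivation.leibniz, Derivation.leibniz_pow, hDg, pow_succ]
      ring
    · simp only [robertsD, mkDerivation_monomial]
      rw [Finsupp.sum_single_index (by simp), smul_eq_mul, ← smul_mul_assoc, mul_comm,
        smul_monomial, ← Finsupp.single_tsub, Nat.add_sub_cancel]
      congr 2
      have := Nat.cast_ne_zero (R := k).2 m.factorial_ne_zero
      have := Nat.cast_ne_zero (R := k).2 m.succ_ne_zero
      rw [Nat.factorial_succ]
      rw [smul_eq_mul]
      push_cast at *
      field_simp
  · rw [coeff_sum, Finset.sum_eq_single (0, n)]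
    · simp [hg0, coeff_mul_monomial, n.factorial_ne_zero]
    · rintro ⟨i, j⟩ hij hne
      obtain rfl : i + j = n := Finset.HasAntidiagonal.mem_antidiagonal.1 hij
      rw [Finsupp.single_add, ← add_assoc, coeff_mul_monomial]
      have hi : i ≠ 0 := fun h => hne (by simp [h])
      have h0 : coeff (Finsupp.single 0 1 + Finsupp.single 6 i) (g i) = 0 := by
        by_contra h
        exact hi (by simpa using hg i (mem_support_iff.2 h))
      rcases neg_one_pow_eq_or (MvPolynomial (Fin 7) k) i with h | h <;> simp [h, h0]
    · simp

lemma coeff_single_eq_zero_of_mem_robertsA [CharZero k] {f : MvPolynomial (Fin 7) k}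
    (hf : f ∈ robertsA k) (n : ℕ) : coeff (Finsupp.single 6 (n + 1)) f = 0 := by
  set m : Fin 7 →₀ ℕ :=
    Finsupp.single 0 2 + Finsupp.single 1 2 + Finsupp.single 2 2 + Finsupp.single 6 n with hm
  have hcube (i : Fin 7) (hi : m i < 3) (p : MvPolynomial (Fin 7) k) :
      coeff m (X i ^ 3 * p) = 0 := by
    rw [X_pow_eq_monomial, coeff_monomial_mul', if_neg]
    rw [Finsupp.single_le_iff]
    omega
  have h : coeff m (robertsD k f) = coeff (Finsupp.single 6 (n + 1)) f * (n + 1) := by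
    rw [robertsD, mkDerivation_apply_eq_sum, Fin.sum_univ_seven]
    simp only [Matrix.cons_val, zero_mul, zero_add, coeff_add]
    rw [hcube 0 (by simp [hm]), hcube 1 (by simp [hm]), hcube 2 (by simp [hm]), mul_pow, mul_pow]
    simp only [X_pow_eq_monomial, monomial_mul, zero_add, mul_one]
    rw [hm, coeff_monomial_mul, coeff_pderiv, one_mul, ← Finsupp.single_add,
      Finsupp.single_eq_same]
  rw [show robertsD k f = 0 from hf, coeff_zero] at h
  exact (mul_eq_zero.1 h.symm).resolve_right (by exact_mod_cast n.succ_ne_zero)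

lemma eq_single_of_add_eq {σ : Type*} {u v w : σ →₀ ℕ} {l : σ} (huv : u + v = w)
    (h : ∀ i, i ≠ l → u i ≠ 0 → w i = 0) : u = Finsupp.single l (u l) := by
  ext i
  by_cases hi : i = l
  · rw [hi, Finsupp.single_eq_same]
  · rw [Finsupp.single_eq_of_ne hi]
    by_contra hu
    have := h i hi hu
    rw [← huv, Finsupp.add_apply] at this
    omega

/-- The polynomials without monomials `zⁿ⁺¹`, and without monomials `x₁zⁿ` for `n > N`. -/
noncomputable def boundedLinearPart (k : Type*) [Field k] (N : ℕ) :
    Subalgebra k (MvPolynomial (Fin 7) k) where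
  carrier := {f | (∀ n, coeff (Finsupp.single 6 (n + 1)) f = 0) ∧
    ∀ n, N < n → coeff (Finsupp.single 0 1 + Finsupp.single 6 n) f = 0}
  mul_mem' := by
    rintro f g ⟨hf, hf'⟩ ⟨hg, hg'⟩
    have coeff_mul_coeff_eq_zero {p q : MvPolynomial (Fin 7) k} {u v : Fin 7 →₀ ℕ} {n : ℕ}
        (hn : N < n) (hp : ∀ n, coeff (Finsupp.single 6 (n + 1)) p = 0)
        (hq : ∀ n, N < n → coeff (Finsupp.single 0 1 + Finsupp.single 6 n) q = 0)
        (huv : u + v = Finsupp.single 0 1 + Finsupp.single 6 n) (hu : u 0 = 0) :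
        coeff u p * coeff v q = 0 := by
      have hu' := eq_single_of_add_eq (l := 6) huv fun i hi hui => by
        have : i ≠ 0 := by rintro rfl; exact hui hu
        simp [hi, this]
      rcases h : u 6 with _ | a
      · rw [h, Finsupp.single_zero] at hu'
        rw [hu', zero_add] at huv
        rw [huv, hq n hn, mul_zero]
      · rw [hu', h, hp, zero_mul]
    refine ⟨fun n => ?_, fun n hn => ?_⟩ <;> rw [coeff_mul] <;>
      refine Finset.sum_eq_zero fun ⟨u, v⟩ huv => ?_ <;>
      rw [Finset.HasAntidiagonal.mem_antidiagonal] at huv <;>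
      dsimp only at huv ⊢
    · have hu := eq_single_of_add_eq (l := 6) huv fun i hi _ => Finsupp.single_eq_of_ne hi
      have hv := eq_single_of_add_eq (l := 6) ((add_comm v u).trans huv)
        fun i hi _ => Finsupp.single_eq_of_ne hi
      have h6 := DFunLike.congr_fun huv 6
      rw [Finsupp.add_apply, Finsupp.single_eq_same] at h6
      rcases h : u 6 with _ | a
      · rw [hv, show v 6 = n + 1 by omega, hg, mul_zero]
      · rw [hu, h, hf, zero_mul]
    · have h0 := DFunLike.congr_fun huv 0
      simp only [Finsupp.add_apply, Finsupp.single_eq_same] at h0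
      rw [Finsupp.single_eq_of_ne (by decide)] at h0
      rcases Nat.eq_zero_or_pos (u 0) with hu | hu
      · exact coeff_mul_coeff_eq_zero hn hf hg' huv hu
      · rw [mul_comm]
        exact coeff_mul_coeff_eq_zero hn hg hf' ((add_comm v u).trans huv) (by omega)
  add_mem' := by
    rintro f g ⟨hf, hf'⟩ ⟨hg, hg'⟩
    exact ⟨fun n => by rw [coeff_add, hf, hg, add_zero],
      fun n hn => by rw [coeff_add, hf' n hn, hg' n hn, add_zero]⟩
  algebraMap_mem' r := by
    have hC {e : Fin 7 →₀ ℕ} {i : Fin 7} (he : e i ≠ 0) :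
        coeff e (algebraMap k (MvPolynomial (Fin 7) k) r) = 0 := by
      rw [algebraMap_eq, coeff_C, if_neg]
      rintro rfl
      exact he rfl
    exact ⟨fun n => hC (i := 6) (by simp), fun n _ => hC (i := 0) (by simp)⟩

lemma mem_boundedLinearPart_of_totalDegree_le [CharZero k] {N : ℕ} {f : MvPolynomial (Fin 7) k}
    (hf : f ∈ robertsA k) (hN : f.totalDegree ≤ N) : f ∈ boundedLinearPart k N := by
  refine ⟨coeff_single_eq_zero_of_mem_robertsA hf, fun n hn => ?_⟩
  refine coeff_eq_zero_of_totalDegree_lt (hN.trans_lt (hn.trans_le ?_))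
  change n ≤ Finsupp.degree _
  simp

end NotFinitelyGenerated

/-- Roberts' counterexample to Hilbert's fourteenth problem: the kernel of the derivation
`D = x₁³ ∂/∂y₁ + x₂³ ∂/∂y₂ + x₃³ ∂/∂y₃ + (x₁x₂x₃)² ∂/∂z`, i.e. the ring of invariants of
the corresponding `𝔾ₐ`-action on `𝔸⁷`, is not a finitely generated `k`-algebra. -/
theorem stmt_18 (k : Type*) [Field k] [CharZero k] :
    ¬ Algebra.FiniteType k ↥(robertsA k) := by
  rw [← Subalgebra.fg_iff_finiteType]
  rintro ⟨S, hS⟩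
  have hle : robertsA k ≤ boundedLinearPart k (S.sup totalDegree) := by
    rw [← hS]
    refine Algebra.adjoin_le fun f hf => mem_boundedLinearPart_of_totalDegree_le ?_
      (Finset.le_sup hf)
    rw [← hS]
    exact Algebra.subset_adjoin hf
  obtain ⟨f, hf, hne⟩ := exists_mem_robertsA_coeff_ne_zero k (S.sup totalDegree + 1)
  exact hne ((hle hf).2 _ (Nat.lt_succ_self _))
end

section
/- Let k be a field of characteristic 0 and R = k[x₁, x₂, x₃, y₁, y₂, y₃, z]. Let A₁ ⊆ R be the k-subalgebra generated by the nine polynomials x₁, x₂, x₃, u₁₂ = x₁³y₂ − x₂³y₁, u₁₃ = x₁³y₃ − x₃³y₁, u₂₃ = x₂³y₃ − x₃³y₂, b₁ = x₁z − x₂²x₃²y₁, b₂ = x₂z − x₁²x₃²y₂, b₃ = x₃z − x₁²x₂²y₃. Then A₁ is a normal domain, i.e., A₁ is integrally closed in its field of fractions. -/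
open MvPolynomial

/-- The subalgebra `A₁ ⊆ k[x₁,x₂,x₃,y₁,y₂,y₃,z]` generated by the nine invariants
`x₁, x₂, x₃, u₁₂, u₁₃, u₂₃, b₁, b₂, b₃` of Roberts' action (variables are indexed
`0,…,6` as `x₁,x₂,x₃,y₁,y₂,y₃,z`). -/
noncomputable def robertsA1 (k : Type*) [Field k] :
    Subalgebra k (MvPolynomial (Fin 7) k) :=
  Algebra.adjoin k
    {X 0, X 1, X 2,
     X 0 ^ 3 * X 4 - X 1 ^ 3 * X 3,
     X 0 ^ 3 * X 5 - X 2 ^ 3 * X 3,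
     X 1 ^ 3 * X 5 - X 2 ^ 3 * X 4,
     X 0 * X 6 - X 1 ^ 2 * X 2 ^ 2 * X 3,
     X 1 * X 6 - X 0 ^ 2 * X 2 ^ 2 * X 4,
     X 2 * X 6 - X 0 ^ 2 * X 1 ^ 2 * X 5}

namespace RobertsA1

variable {k : Type*} [Field k]

local notation "A₁" => robertsA1 k

/-! ### Generators and relations -/

noncomputable def x₁ : A₁ := ⟨X 0, Algebra.subset_adjoin (by simp)⟩

noncomputable def x₂ : A₁ := ⟨X 1, Algebra.subset_adjoin (by simp)⟩

noncomputable def x₃ : A₁ := ⟨X 2, Algebra.subset_adjoin (by simp)⟩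

/-- The invariant `-u₂₃`. -/
noncomputable def a₁ : A₁ :=
  -⟨X 1 ^ 3 * X 5 - X 2 ^ 3 * X 4, Algebra.subset_adjoin (by simp)⟩

/-- The invariant `-u₁₃`. -/
noncomputable def a₂ : A₁ :=
  -⟨X 0 ^ 3 * X 5 - X 2 ^ 3 * X 3, Algebra.subset_adjoin (by simp)⟩

/-- The invariant `-u₁₂`. -/
noncomputable def a₃ : A₁ :=
  -⟨X 0 ^ 3 * X 4 - X 1 ^ 3 * X 3, Algebra.subset_adjoin (by simp)⟩

noncomputable def b₁ : A₁ :=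
  ⟨X 0 * X 6 - X 1 ^ 2 * X 2 ^ 2 * X 3, Algebra.subset_adjoin (by simp)⟩

noncomputable def b₂ : A₁ :=
  ⟨X 1 * X 6 - X 0 ^ 2 * X 2 ^ 2 * X 4, Algebra.subset_adjoin (by simp)⟩

noncomputable def b₃ : A₁ :=
  ⟨X 2 * X 6 - X 0 ^ 2 * X 1 ^ 2 * X 5, Algebra.subset_adjoin (by simp)⟩

lemma coe_x₁ : ((x₁ : A₁) : MvPolynomial (Fin 7) k) = X 0 := rfl

lemma coe_x₂ : ((x₂ : A₁) : MvPolynomial (Fin 7) k) = X 1 := rfl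

lemma coe_x₃ : ((x₃ : A₁) : MvPolynomial (Fin 7) k) = X 2 := rfl

lemma coe_a₁ : ((a₁ : A₁) : MvPolynomial (Fin 7) k) = X 2 ^ 3 * X 4 - X 1 ^ 3 * X 5 :=
  neg_sub _ _

lemma coe_a₂ : ((a₂ : A₁) : MvPolynomial (Fin 7) k) = X 2 ^ 3 * X 3 - X 0 ^ 3 * X 5 :=
  neg_sub _ _

lemma coe_a₃ : ((a₃ : A₁) : MvPolynomial (Fin 7) k) = X 1 ^ 3 * X 3 - X 0 ^ 3 * X 4 :=
  neg_sub _ _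

lemma coe_b₁ :
    ((b₁ : A₁) : MvPolynomial (Fin 7) k) = X 0 * X 6 - X 1 ^ 2 * X 2 ^ 2 * X 3 := rfl

lemma coe_b₂ :
    ((b₂ : A₁) : MvPolynomial (Fin 7) k) = X 1 * X 6 - X 0 ^ 2 * X 2 ^ 2 * X 4 := rfl

lemma coe_b₃ :
    ((b₃ : A₁) : MvPolynomial (Fin 7) k) = X 2 * X 6 - X 0 ^ 2 * X 1 ^ 2 * X 5 := rfl

lemma x₂_mul_b₃ : (x₂ * b₃ : A₁) = x₃ * b₂ + x₁ * (x₁ * a₁) := by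
  apply Subtype.ext
  push_cast [coe_x₁, coe_x₂, coe_x₃, coe_a₁, coe_b₂, coe_b₃]
  ring

lemma x₃_mul_b₁ : (x₃ * b₁ : A₁) = -(x₂ ^ 2 * a₂) + x₁ * b₃ := by
  apply Subtype.ext
  push_cast [coe_x₁, coe_x₂, coe_x₃, coe_a₂, coe_b₁, coe_b₃]
  ring

lemma x₂_mul_b₁ : (x₂ * b₁ : A₁) = -(x₃ ^ 2 * a₃) + x₁ * b₂ := by
  apply Subtype.ext
  push_cast [coe_x₁, coe_x₂, coe_x₃, coe_a₃, coe_b₁, coe_b₂]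
  ring

lemma x₂_pow_three_mul_a₂ : (x₂ ^ 3 * a₂ : A₁) = x₃ ^ 3 * a₃ + x₁ * (x₁ ^ 2 * a₁) := by
  apply Subtype.ext
  push_cast [coe_x₁, coe_x₂, coe_x₃, coe_a₁, coe_a₂, coe_a₃]
  ring

lemma x₂_sq_mul_a₂_mul_b₂ :
    (x₂ ^ 2 * a₂ * b₂ : A₁) = x₃ ^ 2 * a₃ * b₃ + x₁ * (x₁ * a₁ * b₁) := by
  apply Subtype.ext
  push_cast [coe_x₁, coe_x₂, coe_x₃, coe_a₁, coe_a₂, coe_a₃, coe_b₁, coe_b₂, coe_b₃]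
  ring

lemma x₂_mul_a₂_mul_b₂_sq :
    (x₂ * a₂ * b₂ ^ 2 : A₁) =
      x₃ * a₃ * b₃ ^ 2 + x₁ * (a₁ * b₁ ^ 2 - x₂ * x₃ * a₁ * a₂ * a₃) := by
  apply Subtype.ext
  push_cast [coe_x₁, coe_x₂, coe_x₃, coe_a₁, coe_a₂, coe_a₃, coe_b₁, coe_b₂, coe_b₃]
  ring

lemma a₂_mul_b₂_pow_three :
    (a₂ * b₂ ^ 3 : A₁) =
      a₃ * b₃ ^ 3 + a₁ * b₁ ^ 3 + x₃ ^ 3 * a₁ * a₂ * a₃ ^ 2 +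
        x₁ * (-(a₁ * a₂ * a₃ * (x₃ * b₂ + x₃ * b₂ + x₂ * b₃))) := by
  apply Subtype.ext
  push_cast [coe_x₁, coe_x₂, coe_x₃, coe_a₁, coe_a₂, coe_a₃, coe_b₁, coe_b₂, coe_b₃]
  ring

/-! ### Normal monomials modulo `x₁` -/

/-- Exponents of a monomial in the generators other than `x₁`. -/
@[ext]
structure Exponents where
  x₂ : ℕ
  x₃ : ℕ
  a₁ : ℕ
  a₂ : ℕ
  a₃ : ℕ
  b₁ : ℕ
  b₂ : ℕ
  b₃ : ℕ

/-- The monomial in the generators with given exponents. -/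
noncomputable def mon (e : Exponents) : A₁ :=
  x₂ ^ e.x₂ * x₃ ^ e.x₃ * a₁ ^ e.a₁ * a₂ ^ e.a₂ * a₃ ^ e.a₃ * b₁ ^ e.b₁ * b₂ ^ e.b₂ * b₃ ^ e.b₃

/-- The monomials that form a basis of `A₁` modulo `x₁`. -/
def Exponents.IsNormal (e : Exponents) : Prop :=
  (e.b₁ = 0 ∨ e.x₂ = 0 ∧ e.x₃ = 0) ∧ (e.x₂ = 0 ∨ e.b₃ = 0) ∧ (e.a₂ = 0 ∨ e.x₂ + e.b₂ ≤ 2)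

variable (k) in
/-- The elements that are linear combinations of normal monomials modulo `x₁`. -/
noncomputable def normalSpan : Submodule k A₁ :=
  Submodule.span k (mon '' {e | e.IsNormal}) ⊔ LinearMap.range (LinearMap.mulLeft k (x₁ : A₁))

lemma x₁_mul_mem_normalSpan (f : A₁) : x₁ * f ∈ normalSpan k :=
  Submodule.mem_sup_right ⟨f, rfl⟩

/-- Each non-normal monomial rewrites modulo `x₁` to monomials of smaller weight. -/
lemma mon_mem_normalSpan (e : Exponents) : mon e ∈ normalSpan k := by
  induction h : 2 * e.x₂ + 5 * e.b₁ + 6 * e.b₂ + 5 * e.b₃ using Nat.strong_induction_on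
    generalizing e with
  | _ w ih =>
  subst h
  by_cases he : e.IsNormal
  · exact Submodule.mem_sup_left (Submodule.subset_span ⟨e, he, rfl⟩)
  obtain ⟨i, j, l, m, n, o, p, q⟩ := e
  have hcases : (1 ≤ o ∧ 1 ≤ i) ∨ (1 ≤ o ∧ 1 ≤ j) ∨ (1 ≤ i ∧ 1 ≤ q) ∨ (1 ≤ m ∧ 3 ≤ i) ∨
      (1 ≤ m ∧ 2 ≤ i ∧ 1 ≤ p) ∨ (1 ≤ m ∧ 1 ≤ i ∧ 2 ≤ p) ∨ (1 ≤ m ∧ 3 ≤ p) := by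
    simp only [Exponents.IsNormal] at he
    omega
  rcases hcases with ⟨ho, hi⟩ | ⟨ho, hj⟩ | ⟨hi, hq⟩ | ⟨hm, hi⟩ | ⟨hm, hi, hp⟩ | ⟨hm, hi, hp⟩ |
    ⟨hm, hp⟩
  · obtain ⟨o, rfl⟩ := Nat.exists_eq_add_of_le' ho
    obtain ⟨i, rfl⟩ := Nat.exists_eq_add_of_le' hi
    have h := add_mem (neg_mem (ih _ (by dsimp only; omega) ⟨i, j + 2, l, m, n + 1, o, p, q⟩ rfl))
      (x₁_mul_mem_normalSpan (b₂ * mon ⟨i, j, l, m, n, o, p, q⟩))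
    convert h using 1
    simp only [mon]
    linear_combination (x₂ ^ i * x₃ ^ j * a₁ ^ l * a₂ ^ m * a₃ ^ n * b₁ ^ o * b₂ ^ p * b₃ ^ q : A₁)
      * x₂_mul_b₁ (k := k)
  · obtain ⟨o, rfl⟩ := Nat.exists_eq_add_of_le' ho
    obtain ⟨j, rfl⟩ := Nat.exists_eq_add_of_le' hj
    have h := add_mem (neg_mem (ih _ (by dsimp only; omega) ⟨i + 2, j, l, m + 1, n, o, p, q⟩ rfl))
      (x₁_mul_mem_normalSpan (b₃ * mon ⟨i, j, l, m, n, o, p, q⟩))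
    convert h using 1
    simp only [mon]
    linear_combination (x₂ ^ i * x₃ ^ j * a₁ ^ l * a₂ ^ m * a₃ ^ n * b₁ ^ o * b₂ ^ p * b₃ ^ q : A₁)
      * x₃_mul_b₁ (k := k)
  · obtain ⟨i, rfl⟩ := Nat.exists_eq_add_of_le' hi
    obtain ⟨q, rfl⟩ := Nat.exists_eq_add_of_le' hq
    have h := add_mem (ih _ (by dsimp only; omega) ⟨i, j + 1, l, m, n, o, p + 1, q⟩ rfl)
      (x₁_mul_mem_normalSpan (x₁ * a₁ * mon ⟨i, j, l, m, n, o, p, q⟩))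
    convert h using 1
    simp only [mon]
    linear_combination (x₂ ^ i * x₃ ^ j * a₁ ^ l * a₂ ^ m * a₃ ^ n * b₁ ^ o * b₂ ^ p * b₃ ^ q : A₁)
      * x₂_mul_b₃ (k := k)
  · obtain ⟨m, rfl⟩ := Nat.exists_eq_add_of_le' hm
    obtain ⟨i, rfl⟩ := Nat.exists_eq_add_of_le' hi
    have h := add_mem (ih _ (by dsimp only; omega) ⟨i, j + 3, l, m, n + 1, o, p, q⟩ rfl)
      (x₁_mul_mem_normalSpan (x₁ ^ 2 * a₁ * mon ⟨i, j, l, m, n, o, p, q⟩))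
    convert h using 1
    simp only [mon]
    linear_combination (x₂ ^ i * x₃ ^ j * a₁ ^ l * a₂ ^ m * a₃ ^ n * b₁ ^ o * b₂ ^ p * b₃ ^ q : A₁)
      * x₂_pow_three_mul_a₂ (k := k)
  · obtain ⟨m, rfl⟩ := Nat.exists_eq_add_of_le' hm
    obtain ⟨i, rfl⟩ := Nat.exists_eq_add_of_le' hi
    obtain ⟨p, rfl⟩ := Nat.exists_eq_add_of_le' hp
    have h := add_mem (ih _ (by dsimp only; omega) ⟨i, j + 2, l, m, n + 1, o, p, q + 1⟩ rfl)
      (x₁_mul_mem_normalSpan (x₁ * a₁ * b₁ * mon ⟨i, j, l, m, n, o, p, q⟩))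
    convert h using 1
    simp only [mon]
    linear_combination (x₂ ^ i * x₃ ^ j * a₁ ^ l * a₂ ^ m * a₃ ^ n * b₁ ^ o * b₂ ^ p * b₃ ^ q : A₁)
      * x₂_sq_mul_a₂_mul_b₂ (k := k)
  · obtain ⟨m, rfl⟩ := Nat.exists_eq_add_of_le' hm
    obtain ⟨i, rfl⟩ := Nat.exists_eq_add_of_le' hi
    obtain ⟨p, rfl⟩ := Nat.exists_eq_add_of_le' hp
    have h := add_mem (ih _ (by dsimp only; omega) ⟨i, j + 1, l, m, n + 1, o, p, q + 2⟩ rfl)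
      (x₁_mul_mem_normalSpan
        ((a₁ * b₁ ^ 2 - x₂ * x₃ * a₁ * a₂ * a₃) * mon ⟨i, j, l, m, n, o, p, q⟩))
    convert h using 1
    simp only [mon]
    linear_combination (x₂ ^ i * x₃ ^ j * a₁ ^ l * a₂ ^ m * a₃ ^ n * b₁ ^ o * b₂ ^ p * b₃ ^ q : A₁)
      * x₂_mul_a₂_mul_b₂_sq (k := k)
  · obtain ⟨m, rfl⟩ := Nat.exists_eq_add_of_le' hm
    obtain ⟨p, rfl⟩ := Nat.exists_eq_add_of_le' hp
    have h := add_mem (add_mem (add_mem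
      (ih _ (by dsimp only; omega) ⟨i, j, l, m, n + 1, o, p, q + 3⟩ rfl)
      (ih _ (by dsimp only; omega) ⟨i, j, l + 1, m, n, o + 3, p, q⟩ rfl))
      (ih _ (by dsimp only; omega) ⟨i, j + 3, l + 1, m + 1, n + 2, o, p, q⟩ rfl))
      (x₁_mul_mem_normalSpan
        (-(a₁ * a₂ * a₃ * (x₃ * b₂ + x₃ * b₂ + x₂ * b₃)) * mon ⟨i, j, l, m, n, o, p, q⟩))
    convert h using 1
    simp only [mon]
    linear_combination (x₂ ^ i * x₃ ^ j * a₁ ^ l * a₂ ^ m * a₃ ^ n * b₁ ^ o * b₂ ^ p * b₃ ^ q : A₁)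
      * a₂_mul_b₂_pow_three (k := k)

lemma mon_mul_mon (e f : Exponents) :
    (mon e * mon f : A₁) = mon ⟨e.x₂ + f.x₂, e.x₃ + f.x₃, e.a₁ + f.a₁, e.a₂ + f.a₂,
      e.a₃ + f.a₃, e.b₁ + f.b₁, e.b₂ + f.b₂, e.b₃ + f.b₃⟩ := by
  simp only [mon]
  ring

lemma exists_coe_eq_of_mem_closure {f : MvPolynomial (Fin 7) k}
    (hf : f ∈ Submonoid.closure
      ({X 0, X 1, X 2,
        X 0 ^ 3 * X 4 - X 1 ^ 3 * X 3,
        X 0 ^ 3 * X 5 - X 2 ^ 3 * X 3,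
        X 1 ^ 3 * X 5 - X 2 ^ 3 * X 4,
        X 0 * X 6 - X 1 ^ 2 * X 2 ^ 2 * X 3,
        X 1 * X 6 - X 0 ^ 2 * X 2 ^ 2 * X 4,
        X 2 * X 6 - X 0 ^ 2 * X 1 ^ 2 * X 5} : Set (MvPolynomial (Fin 7) k))) :
    ∃ a : A₁, (a : MvPolynomial (Fin 7) k) = f ∧
      ((∃ b, a = x₁ * b) ∨ ∃ (c : k) (e : Exponents), a = c • mon e) := by
  induction hf using Submonoid.closure_induction with
  | mem f hf =>
    rcases hf with rfl | rfl | rfl | rfl | rfl | rfl | rfl | rfl | rfl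
    · exact ⟨x₁, rfl, .inl ⟨1, (mul_one _).symm⟩⟩
    · exact ⟨x₂, rfl, .inr ⟨1, ⟨1, 0, 0, 0, 0, 0, 0, 0⟩, by simp [mon]⟩⟩
    · exact ⟨x₃, rfl, .inr ⟨1, ⟨0, 1, 0, 0, 0, 0, 0, 0⟩, by simp [mon]⟩⟩
    · exact ⟨-a₃, by simp [coe_a₃], .inr ⟨-1, ⟨0, 0, 0, 0, 1, 0, 0, 0⟩, by simp [mon]⟩⟩
    · exact ⟨-a₂, by simp [coe_a₂], .inr ⟨-1, ⟨0, 0, 0, 1, 0, 0, 0, 0⟩, by simp [mon]⟩⟩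
    · exact ⟨-a₁, by simp [coe_a₁], .inr ⟨-1, ⟨0, 0, 1, 0, 0, 0, 0, 0⟩, by simp [mon]⟩⟩
    · exact ⟨b₁, rfl, .inr ⟨1, ⟨0, 0, 0, 0, 0, 1, 0, 0⟩, by simp [mon]⟩⟩
    · exact ⟨b₂, rfl, .inr ⟨1, ⟨0, 0, 0, 0, 0, 0, 1, 0⟩, by simp [mon]⟩⟩
    · exact ⟨b₃, rfl, .inr ⟨1, ⟨0, 0, 0, 0, 0, 0, 0, 1⟩, by simp [mon]⟩⟩
  | one => exact ⟨1, rfl, .inr ⟨1, ⟨0, 0, 0, 0, 0, 0, 0, 0⟩, by simp [mon]⟩⟩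
  | mul f g _ _ hf hg =>
    obtain ⟨a, rfl, ha⟩ := hf
    obtain ⟨b, rfl, hb⟩ := hg
    refine ⟨a * b, rfl, ?_⟩
    rcases ha with ⟨a, rfl⟩ | ⟨c, e, rfl⟩
    · exact .inl ⟨a * b, mul_assoc _ _ _⟩
    rcases hb with ⟨b, rfl⟩ | ⟨d, e', rfl⟩
    · exact .inl ⟨c • mon e * b, mul_left_comm _ _ _⟩
    · exact .inr ⟨c * d, _, by rw [smul_mul_smul_comm, mon_mul_mon]⟩

lemma mem_normalSpan (f : A₁) : f ∈ normalSpan k := by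
  have key : ∀ g ∈ robertsA1 k, g ∈ (normalSpan k).map (robertsA1 k).val.toLinearMap := by
    intro g hg
    rw [robertsA1, ← Subalgebra.mem_toSubmodule, Algebra.adjoin_eq_span] at hg
    refine Submodule.span_le.mpr (fun s hs ↦ ?_) hg
    obtain ⟨a, rfl, ha⟩ := exists_coe_eq_of_mem_closure hs
    refine ⟨a, ?_, rfl⟩
    rcases ha with ⟨b, rfl⟩ | ⟨c, e, rfl⟩
    · exact x₁_mul_mem_normalSpan b
    · exact Submodule.smul_mem _ _ (mon_mem_normalSpan e)
  obtain ⟨a, ha, haf⟩ := key f f.2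
  rwa [← Subtype.ext haf]

lemma exists_normal_form (f : A₁) :
    ∃ (c : Exponents →₀ k) (g : A₁), (∀ e ∈ c.support, e.IsNormal) ∧
      f = (c.sum fun e r ↦ r • mon e) + x₁ * g := by
  obtain ⟨s, hs, _, ⟨g, rfl⟩, rfl⟩ := Submodule.mem_sup.mp (mem_normalSpan f)
  obtain ⟨c, hc, rfl⟩ := (Finsupp.mem_span_image_iff_linearCombination k).mp hs
  exact ⟨c, g, fun e he ↦ hc he, rfl⟩

/-! ### Specializations -/

/-- The specialization of `A₁` to the exceptional divisor of the chart
`x₂ = s x₁`, `x₃ = t x₁` of the blow-up of `x₁ = x₂ = x₃ = 0`. -/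
lemma exists_specialization {F : Type*} [CommRing F] [IsDomain F] [Algebra k F] (s t b p q : F) :
    ∃ ψ : A₁ →ₐ[k] F, ψ x₁ = 0 ∧ ψ x₂ = 0 ∧ ψ x₃ = 0 ∧ ψ a₁ = s ^ 3 * p - t ^ 3 * q ∧
      ψ a₂ = p ∧ ψ a₃ = q ∧ ψ b₁ = b ∧ ψ b₂ = s * b ∧ ψ b₃ = t * b := by
  let ι : Polynomial F →ₐ[k] FractionRing (Polynomial F) := IsScalarTower.toAlgHom k _ _
  have hι : Function.Injective ι := IsFractionRing.injective (Polynomial F) _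
  let w : Polynomial F := Polynomial.X
  have hw : ι w ≠ 0 := (map_ne_zero_iff ι hι).mpr Polynomial.X_ne_zero
  let c : F → Polynomial F := Polynomial.C
  let π : MvPolynomial (Fin 7) k →ₐ[k] FractionRing (Polynomial F) :=
    aeval ![ι w, ι (w * c s), ι (w * c t), 0, -ι (c q) / ι w ^ 3, -ι (c p) / ι w ^ 3,
      ι (c b) / ι w]
  have h0 : π (X 0) = ι w := by simp [π]
  have h1 : π (X 1) = ι w * ι (c s) := by simp [π]
  have h2 : π (X 2) = ι w * ι (c t) := by simp [π]
  have h3 : π (X 3) = 0 := by simp [π]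
  have h4 : π (X 4) = -ι (c q) / ι w ^ 3 := by simp [π]
  have h5 : π (X 5) = -ι (c p) / ι w ^ 3 := by simp [π]
  have h6 : π (X 6) = ι (c b) / ι w := by simp [π]
  have hx₁ : π (x₁ : A₁) = ι w := h0
  have hx₂ : π (x₂ : A₁) = ι (w * c s) := by rw [coe_x₂, h1, map_mul]
  have hx₃ : π (x₃ : A₁) = ι (w * c t) := by rw [coe_x₃, h2, map_mul]
  have ha₁ : π (a₁ : A₁) = ι (c s ^ 3 * c p - c t ^ 3 * c q) := by
    simp only [coe_a₁, map_sub, map_mul, map_pow, h1, h2, h4, h5]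
    field_simp
    ring
  have ha₂ : π (a₂ : A₁) = ι (c p) := by
    simp only [coe_a₂, map_sub, map_mul, map_pow, h0, h2, h3, h5]
    field_simp
    ring
  have ha₃ : π (a₃ : A₁) = ι (c q) := by
    simp only [coe_a₃, map_sub, map_mul, map_pow, h0, h1, h3, h4]
    field_simp
    ring
  have hb₁ : π (b₁ : A₁) = ι (c b) := by
    simp only [coe_b₁, map_sub, map_mul, map_pow, h0, h1, h2, h3, h6]
    field_simp
    ring
  have hb₂ : π (b₂ : A₁) = ι (c s * c b + w * c t ^ 2 * c q) := by
    simp only [coe_b₂, map_sub, map_add, map_mul, map_pow, h0, h1, h2, h4, h6]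
    field_simp
    ring
  have hb₃ : π (b₃ : A₁) = ι (c t * c b + w * c s ^ 2 * c p) := by
    simp only [coe_b₃, map_sub, map_add, map_mul, map_pow, h0, h1, h2, h5, h6]
    field_simp
    ring
  have hrange : robertsA1 k ≤ ι.range.comap π := by
    refine Algebra.adjoin_le ?_
    rintro _ (rfl | rfl | rfl | rfl | rfl | rfl | rfl | rfl | rfl)
    · exact ⟨_, hx₁.symm⟩
    · exact ⟨_, hx₂.symm⟩
    · exact ⟨_, hx₃.symm⟩
    · exact ⟨-c q, (map_neg ι _).trans <| by rw [← ha₃, ← map_neg, coe_a₃, neg_sub]; rfl⟩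
    · exact ⟨-c p, (map_neg ι _).trans <| by rw [← ha₂, ← map_neg, coe_a₂, neg_sub]; rfl⟩
    · exact ⟨-(c s ^ 3 * c p - c t ^ 3 * c q),
        (map_neg ι _).trans <| by rw [← ha₁, ← map_neg, coe_a₁, neg_sub]; rfl⟩
    · exact ⟨_, hb₁.symm⟩
    · exact ⟨_, hb₂.symm⟩
    · exact ⟨_, hb₃.symm⟩
  let ψ : A₁ →ₐ[k] Polynomial F := (AlgEquiv.ofInjective ι hι).symm.toAlgHom.comp
    ((π.comp (robertsA1 k).val).codRestrict ι.range fun f ↦ hrange f.2)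
  have hψ : ∀ {f e}, π ((f : A₁) : MvPolynomial (Fin 7) k) = ι e → ψ f = e := by
    intro f e h
    change (AlgEquiv.ofInjective ι hι).symm _ = e
    rw [AlgEquiv.symm_apply_eq]
    exact Subtype.ext h
  refine ⟨((Polynomial.aeval (0 : F)).restrictScalars k).comp ψ, ?_⟩
  simp [hψ hx₁, hψ hx₂, hψ hx₃, hψ ha₁, hψ ha₂, hψ ha₃, hψ hb₁, hψ hb₂, hψ hb₃, w, c]

variable (k) in
/-- The specialization of `A₁` at `x₁ = y₂ = 0`, with the sign of `y₃` reversed. -/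
noncomputable def specialization : MvPolynomial (Fin 7) k →ₐ[k] MvPolynomial (Fin 7) k :=
  aeval ![0, X 1, X 2, X 3, 0, -X 5, X 6]

lemma specialization_mon {e : Exponents} (he : e.b₁ = 0) :
    specialization k (mon e : A₁) =
      monomial (Finsupp.single 1 (e.x₂ + 3 * e.a₁ + 3 * e.a₃ + e.b₂) +
        Finsupp.single 2 (e.x₃ + 3 * e.a₂ + e.b₃) + Finsupp.single 3 (e.a₂ + e.a₃) +
        Finsupp.single 5 e.a₁ + Finsupp.single 6 (e.b₂ + e.b₃)) 1 := by
  have h0 : specialization k (X 0) = 0 := by simp [specialization]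
  have h1 : specialization k (X 1) = X 1 := by simp [specialization]
  have h2 : specialization k (X 2) = X 2 := by simp [specialization]
  have h3 : specialization k (X 3) = X 3 := by simp [specialization]
  have h4 : specialization k (X 4) = 0 := by simp [specialization]
  have h5 : specialization k (X 5) = -X 5 := by simp [specialization]
  have h6 : specialization k (X 6) = X 6 := by simp [specialization]
  simp only [monomial_add_single, ← X_pow_eq_monomial]
  simp only [mon, he]
  push_cast [coe_x₂, coe_x₃, coe_a₁, coe_a₂, coe_a₃, coe_b₂, coe_b₃]
  simp only [map_mul, map_pow, map_sub, h0, h1, h2, h3, h4, h5, h6]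
  ring

lemma natDegree_le_and_coeff_eq {K : Type*} [CommRing K] (p r κ : K) (l m : ℕ) :
    ((.X ^ 3 * .C p - .C r) ^ l * .X ^ m * .C κ : Polynomial K).natDegree ≤ l * 3 + m ∧
      ((.X ^ 3 * .C p - .C r) ^ l * .X ^ m * .C κ : Polynomial K).coeff (l * 3 + m) =
        p ^ l * κ := by
  have hd : (.X ^ 3 * .C p - .C r : Polynomial K).natDegree ≤ 3 := by compute_degree
  have hc : (.X ^ 3 * .C p - .C r : Polynomial K).coeff 3 = p := by
    simp
  refine ⟨?_, ?_⟩
  · refine Polynomial.natDegree_mul_C_le _ _ |>.trans <| Polynomial.natDegree_mul_le_of_le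
      (Polynomial.natDegree_pow_le_of_le _ hd) (Polynomial.natDegree_X_pow_le _)
  · rw [Polynomial.coeff_mul_C, Polynomial.coeff_mul_X_pow,
      Polynomial.coeff_pow_of_natDegree_le hd, hc]

/-- A linear combination of polynomials vanishes only trivially if the coefficients in prescribed
top degrees are monomials and the pairs of degree and monomial are distinct. -/
lemma eq_zero_of_sum_smul_eq_zero {σ α : Type*} (v : α → Polynomial (MvPolynomial σ k))
    (d : α → ℕ) (μ : α → σ →₀ ℕ) (s : Finset α) (c : α → k)
    (hd : ∀ a ∈ s, (v a).natDegree ≤ d a) (hc : ∀ a ∈ s, (v a).coeff (d a) = monomial (μ a) 1)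
    (hinj : ∀ a ∈ s, ∀ b ∈ s, d a = d b → μ a = μ b → a = b)
    (hsum : ∑ a ∈ s, c a • v a = 0) : ∀ a ∈ s, c a = 0 := by
  classical
  by_contra! hne
  obtain ⟨a, ha, hmax⟩ := (s.filter (c · ≠ 0)).exists_max_image d
    (hne.imp fun a ha ↦ Finset.mem_filter.mpr ha)
  obtain ⟨has, hca⟩ := Finset.mem_filter.mp ha
  have h := congrArg (fun f ↦ coeff (μ a) (Polynomial.coeff f (d a))) hsum
  simp only [Polynomial.finsetSum_coeff, coeff_sum, Polynomial.coeff_smul, coeff_smul,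
    Polynomial.coeff_zero, coeff_zero] at h
  rw [Finset.sum_eq_single_of_mem a has, hc a has, coeff_monomial, if_pos rfl] at h
  · exact hca (by simpa using h)
  · intro b hb hba
    by_cases hcb : c b = 0
    · rw [hcb, zero_smul]
    rcases (hmax b (Finset.mem_filter.mpr ⟨hb, hcb⟩)).lt_or_eq with hlt | heq
    · rw [Polynomial.coeff_eq_zero_of_natDegree_lt ((hd b hb).trans_lt hlt), coeff_zero, smul_zero]
    · rw [← heq, hc b hb, coeff_monomial, if_neg, smul_zero]
      exact fun hμ ↦ hba (hinj b hb a has heq hμ)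

variable (k) in
/-- The ideal `x₁ A₁` is the intersection of two kernels. -/
lemma exists_eq_x₁_mul : ∃ ψ : A₁ →ₐ[k] Polynomial (MvPolynomial (Fin 4) k), ψ x₁ = 0 ∧
    ∀ h : A₁, ψ h = 0 → specialization k h = 0 → ∃ g, h = x₁ * g := by
  classical
  obtain ⟨ψ, hx₁, hx₂, hx₃, ha₁, ha₂, ha₃, hb₁, hb₂, hb₃⟩ := exists_specialization (k := k)
    (.X : Polynomial (MvPolynomial (Fin 4) k)) (.C (X 0)) (.C (X 1)) (.C (X 2)) (.C (X 3))
  refine ⟨ψ, hx₁, fun h hψ hχ ↦ ?_⟩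
  obtain ⟨c, g, hc, rfl⟩ := exists_normal_form h
  have hsx₁ : specialization k (x₁ : A₁) = 0 := by simp [specialization, coe_x₁]
  rw [map_add, map_mul, hx₁, zero_mul, add_zero, Finsupp.sum, map_sum] at hψ
  have hχ' : ∑ e ∈ c.support, c e • specialization k (mon e : A₁) = 0 := by
    simpa [hsx₁, Finsupp.sum] using hχ
  have hψ' : ∑ e ∈ c.support with e.x₂ = 0 ∧ e.x₃ = 0, c e • ψ (mon e) = 0 := by
    rw [← hψ, Finset.sum_filter]
    refine Finset.sum_congr rfl fun e _ ↦ ?_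
    split_ifs with he
    · rw [map_smul]
    · rw [map_smul, mon]
      rcases not_and_or.mp he with he | he <;> simp [hx₂, hx₃, he]
  have hv : ∀ e : Exponents, e.x₂ = 0 ∧ e.x₃ = 0 → ψ (mon e) =
      (.X ^ 3 * .C (X 2) - .C (X 0 ^ 3 * X 3)) ^ e.a₁ * .X ^ e.b₂ *
        .C (X 2 ^ e.a₂ * X 3 ^ e.a₃ * X 1 ^ (e.b₁ + e.b₂ + e.b₃) * X 0 ^ e.b₃) := by
    rintro e ⟨h₂, h₃⟩
    simp only [mon, h₂, h₃, map_mul, map_pow, ha₁, ha₂, ha₃, hb₁, hb₂, hb₃]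
    ring
  have hzero : ∀ e ∈ c.support, ¬ (e.x₂ = 0 ∧ e.x₃ = 0) := by
    intro e he h0
    refine Finsupp.mem_support_iff.mp he <| eq_zero_of_sum_smul_eq_zero (fun e ↦ ψ (mon e))
      (fun e ↦ e.a₁ * 3 + e.b₂)
      (fun e ↦ Finsupp.single 0 e.b₃ + Finsupp.single 1 (e.b₁ + e.b₂ + e.b₃) +
        Finsupp.single 2 (e.a₁ + e.a₂) + Finsupp.single 3 e.a₃) _ _ ?_ ?_ ?_ hψ' e
        (Finset.mem_filter.mpr ⟨he, h0⟩)
    · intro e he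
      rw [hv e (Finset.mem_filter.mp he).2]
      exact (natDegree_le_and_coeff_eq _ _ _ _ _).1
    · intro e he
      rw [hv e (Finset.mem_filter.mp he).2, (natDegree_le_and_coeff_eq _ _ _ _ _).2]
      simp only [monomial_add_single, ← X_pow_eq_monomial]
      ring
    · intro e he f hf hd hμ
      obtain ⟨he, he₂, he₃⟩ := Finset.mem_filter.mp he
      obtain ⟨hf, hf₂, hf₃⟩ := Finset.mem_filter.mp hf
      have hne := hc e he
      have hnf := hc f hf
      have m0 := DFunLike.congr_fun hμ 0
      have m1 := DFunLike.congr_fun hμ 1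
      have m2 := DFunLike.congr_fun hμ 2
      have m3 := DFunLike.congr_fun hμ 3
      simp at m0 m1 m2 m3
      simp only [Exponents.IsNormal] at hne hnf
      ext <;> omega
  have hall : ∀ e ∈ c.support, c e = 0 := by
    intro e he
    have h := congrArg (coeff (Finsupp.single 1 (e.x₂ + 3 * e.a₁ + 3 * e.a₃ + e.b₂) +
        Finsupp.single 2 (e.x₃ + 3 * e.a₂ + e.b₃) + Finsupp.single 3 (e.a₂ + e.a₃) +
        Finsupp.single 5 e.a₁ + Finsupp.single 6 (e.b₂ + e.b₃))) hχ'
    rw [coeff_sum, coeff_zero, Finset.sum_eq_single_of_mem e he, coeff_smul, specialization_mon,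
      coeff_monomial, if_pos rfl] at h
    · simpa using h
    · exact (hc e he).1.resolve_right (hzero e he)
    · intro f hf hfe
      rw [coeff_smul, specialization_mon ((hc f hf).1.resolve_right (hzero f hf)),
        coeff_monomial, if_neg, smul_zero]
      intro hμ
      apply hfe
      have hne := hc e he
      have hnf := hc f hf
      have hze := hzero e he
      have hzf := hzero f hf
      have m1 := DFunLike.congr_fun hμ 1
      have m2 := DFunLike.congr_fun hμ 2
      have m3 := DFunLike.congr_fun hμ 3
      have m5 := DFunLike.congr_fun hμ 5
      have m6 := DFunLike.congr_fun hμ 6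
      simp at m1 m2 m3 m5 m6
      simp only [Exponents.IsNormal] at hne hnf
      ext <;> omega
  have hsupp : c = 0 := by
    rw [← Finsupp.support_eq_empty]
    exact Finset.eq_empty_of_forall_notMem fun e he ↦ Finsupp.mem_support_iff.mp he (hall e he)
  exact ⟨g, by rw [hsupp, Finsupp.sum_zero_index, zero_add]⟩

/-! ### Integral closure -/

/-- If `x₁ g ∈ A₁` with `g` integral over `A₁`, then `g ∈ A₁`. -/
lemma mem_of_X_zero_mul_mem {g : MvPolynomial (Fin 7) k} (hg : IsIntegral A₁ g)
    (hx : X 0 * g ∈ robertsA1 k) : g ∈ robertsA1 k := by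
  obtain ⟨ψ, hψ, h⟩ := exists_eq_x₁_mul k
  obtain ⟨P, hP, hroot⟩ := hg
  have hzero : (P.scaleRoots x₁).eval ⟨X 0 * g, hx⟩ = 0 := by
    apply Subtype.ext
    have h := Polynomial.scaleRoots_eval₂_eq_zero (algebraMap A₁ _) (s := x₁) hroot
    rw [← Polynomial.coe_aeval_eq_eval]
    exact (Polynomial.aeval_algebraMap_apply (MvPolynomial (Fin 7) k)
      (⟨X 0 * g, hx⟩ : A₁) (P.scaleRoots x₁)).symm.trans h
  have hmap : (P.scaleRoots x₁).map (RingHomClass.toRingHom ψ) = .X ^ P.natDegree := by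
    rw [Polynomial.map_scaleRoots _ _ _ (by simp [hP.leadingCoeff])]
    simp [hψ, hP.natDegree_map, (hP.map _).leadingCoeff]
  have hpow := congrArg ψ hzero
  rw [map_zero, ← AlgHom.coe_toRingHom, ← Polynomial.eval_map_apply, hmap, Polynomial.eval_pow,
    Polynomial.eval_X] at hpow
  have hψg := eq_zero_of_pow_eq_zero hpow
  obtain ⟨f, hf⟩ := h ⟨X 0 * g, hx⟩ hψg (by simp [specialization])
  have hfg : X 0 * g = X 0 * (f : MvPolynomial (Fin 7) k) := congrArg Subtype.val hf
  rw [mul_left_cancel₀ (X_ne_zero 0) hfg]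
  exact f.2

/-- After inverting `x₁`, every polynomial in the fraction field of `A₁` belongs to `A₁`. -/
lemma exists_X_zero_pow_mul_mem {f : MvPolynomial (Fin 7) k} {a b : A₁} (hb : b ≠ 0)
    (hf : b * f = a) : ∃ n : ℕ, X 0 ^ n * f ∈ robertsA1 k := by
  let ι : MvPolynomial (Fin 7) k →ₐ[k] FractionRing (MvPolynomial (Fin 7) k) :=
    IsScalarTower.toAlgHom k _ _
  have hι : Function.Injective ι := IsFractionRing.injective (MvPolynomial (Fin 7) k) _
  have hx : ι (X 0) ≠ 0 := (map_ne_zero_iff ι hι).mpr (X_ne_zero 0)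
  let Φ : MvPolynomial (Fin 7) k →ₐ[k] FractionRing (MvPolynomial (Fin 7) k) :=
    aeval ![ι (X 0), ι (X 1), ι (X 2), 0, -ι (a₃ : A₁) / ι (X 0) ^ 3, -ι (a₂ : A₁) / ι (X 0) ^ 3,
      ι (b₁ : A₁) / ι (X 0)]
  have h0 : Φ (X 0) = ι (X 0) := by simp [Φ]
  have h1 : Φ (X 1) = ι (X 1) := by simp [Φ]
  have h2 : Φ (X 2) = ι (X 2) := by simp [Φ]
  have h3 : Φ (X 3) = 0 := by simp [Φ]
  have h4 : Φ (X 4) = -ι (a₃ : A₁) / ι (X 0) ^ 3 := by simp [Φ]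
  have h5 : Φ (X 5) = -ι (a₂ : A₁) / ι (X 0) ^ 3 := by simp [Φ]
  have h6 : Φ (X 6) = ι (b₁ : A₁) / ι (X 0) := by simp [Φ]
  have hfix : robertsA1 k ≤ AlgHom.equalizer Φ ι := by
    refine Algebra.adjoin_le ?_
    rintro _ (rfl | rfl | rfl | rfl | rfl | rfl | rfl | rfl | rfl) <;>
      change Φ _ = ι _ <;>
      simp only [map_sub, map_mul, map_pow, h0, h1, h2, h3, h4, h5, h6, coe_a₂, coe_a₃, coe_b₁] <;>
      field_simp <;> ring
  have hΦ : ∀ f, ∃ n : ℕ, ∃ g : A₁, ι (X 0) ^ n * Φ f = ι g := by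
    intro f
    induction f using MvPolynomial.induction_on with
    | C r =>
      refine ⟨0, algebraMap k _ r, ?_⟩
      rw [pow_zero, one_mul, ← algebraMap_eq, Φ.commutes]
      exact (ι.commutes r).symm
    | add f₁ f₂ h₁ h₂ =>
      obtain ⟨n₁, g₁, h₁⟩ := h₁
      obtain ⟨n₂, g₂, h₂⟩ := h₂
      refine ⟨n₁ + n₂, x₁ ^ n₂ * g₁ + x₁ ^ n₁ * g₂, ?_⟩
      push_cast [coe_x₁]
      simp only [map_add, map_mul, map_pow, ← h₁, ← h₂]
      ring
    | mul_X f i h =>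
      obtain ⟨n, g, h⟩ := h
      have hi : ∃ m : ℕ, ∃ g' : A₁, ι (X 0) ^ m * Φ (X i) = ι g' := by
        fin_cases i
        · exact ⟨0, x₁, by simp [h0, coe_x₁]⟩
        · exact ⟨0, x₂, by simp [h1, coe_x₂]⟩
        · exact ⟨0, x₃, by simp [h2, coe_x₃]⟩
        · exact ⟨0, 0, by simp [h3]⟩
        · exact ⟨3, -a₃, by simp [h4]; field_simp⟩
        · exact ⟨3, -a₂, by simp [h5]; field_simp⟩
        · exact ⟨1, b₁, by simp [h6]; field_simp⟩
      obtain ⟨m, g', h'⟩ := hi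
      refine ⟨n + m, g * g', ?_⟩
      push_cast
      simp only [map_mul, ← h, ← h']
      ring
  have hf' : Φ f = ι f := by
    have hb' : ι b ≠ 0 := (map_ne_zero_iff ι hι).mpr fun h ↦ hb (Subtype.ext h)
    refine mul_left_cancel₀ hb' ?_
    rw [← map_mul, hf, ← show Φ b = ι b from hfix b.2, ← map_mul, hf]
    exact hfix a.2
  obtain ⟨n, g, h⟩ := hΦ f
  rw [hf', ← map_pow, ← map_mul] at h
  exact ⟨n, hι h ▸ g.2⟩

lemma mem_of_isIntegral {f : MvPolynomial (Fin 7) k} {a b : A₁} (hb : b ≠ 0) (hf : b * f = a)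
    (hint : IsIntegral A₁ f) : f ∈ robertsA1 k := by
  obtain ⟨n, hn⟩ := exists_X_zero_pow_mul_mem hb hf
  have hX : IsIntegral A₁ (X 0 : MvPolynomial (Fin 7) k) := isIntegral_algebraMap (x := x₁)
  induction n with
  | zero => simpa using hn
  | succ n ih =>
    refine ih (mem_of_X_zero_mul_mem ((hX.pow n).mul hint) ?_)
    rwa [← mul_assoc, ← pow_succ']

end RobertsA1

/-- The algebra `A₁ = k[x₁, x₂, x₃, u₁₂, u₁₃, u₂₃, b₁, b₂, b₃]` is a normal domain:
it is integrally closed in its field of fractions. -/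
theorem stmt_19 (k : Type*) [Field k] [CharZero k] :
    IsIntegrallyClosed ↥(robertsA1 k) := by
  let R := MvPolynomial (Fin 7) k
  have hinj : Function.Injective (algebraMap (robertsA1 k) (FractionRing R)) := by
    rw [IsScalarTower.algebraMap_eq (robertsA1 k) R]
    exact (IsFractionRing.injective R (FractionRing R)).comp Subtype.val_injective
  let j : FractionRing (robertsA1 k) →ₐ[robertsA1 k] FractionRing R :=
    IsFractionRing.liftAlgHom (g := Algebra.ofId _ _) hinj
  rw [isIntegrallyClosed_iff (FractionRing (robertsA1 k))]
  intro x hx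
  obtain ⟨a, b, hb, rfl⟩ := IsFractionRing.div_surjective (A := robertsA1 k) x
  have hj : j (algebraMap _ _ a / algebraMap _ _ b) =
      algebraMap R _ a / algebraMap R _ b := by
    rw [map_div₀, j.commutes, j.commutes]
    rfl
  have hint := hx.map j
  obtain ⟨f, hf⟩ := IsIntegrallyClosed.isIntegral_iff.mp (hint.tower_top (A := R))
  have hb0 : b ≠ 0 := nonZeroDivisors.ne_zero hb
  have hbR : algebraMap R (FractionRing R) b ≠ 0 :=
    (map_ne_zero_iff _ (IsFractionRing.injective R _)).mpr fun h ↦ hb0 (Subtype.ext h)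
  have hfb : (b : R) * f = a := by
    apply IsFractionRing.injective R (FractionRing R)
    rw [map_mul, hf, hj, mul_div_cancel₀ _ hbR]
  have hfint : IsIntegral (robertsA1 k) f := by
    rw [← hf] at hint
    exact (isIntegral_algebraMap_iff (IsFractionRing.injective R (FractionRing R))).mp hint
  refine ⟨⟨f, RobertsA1.mem_of_isIntegral hb0 hfb hfint⟩, ?_⟩
  rw [eq_div_iff ((map_ne_zero_iff _ (IsFractionRing.injective _ _)).mpr hb0), ← map_mul]
  exact congrArg _ (Subtype.ext ((mul_comm _ _).trans hfb))
end
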